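/- Fix β > 0 and let F : ℕ → [0,∞) satisfy F(N)/N → F₀ as N → ∞ for some constant 0 ≤ F₀ < 4β. For each N ≥ 2 let λ(N) be the unique real number with Σ_{k=1}^N m(λ(N) + k·F(N)) = 1, write λ_k = λ(N) + k·F(N), let f_{λ_k} be the probability density on ℝ equal to e^{−λ_k x − β/x}/c(λ_k) for x ∈ (0,1) and 0 otherwise, let f_{S_N} = f_{λ_1} * f_{λ_2} * ⋯ * f_{λ_N} be the N-fold convolution (the density of the sum S_{N,λ} of the N independent random variables with these densities), and set σ_N² = Σ_{k=1}^N v(λ_k). Then there exist a constant C > 0 and N₀ ∈ ℕ such that for all N ≥ N₀ and all x ∈ ℝ, | σ_N·f_{S_N}(1 + σ_N·x) − (2π)^{−1/2}·e^{−x²/2} | ≤ C·N^{−1/2}; that is, the density of Z_N = (S_{N,λ} − 1)/σ_N converges uniformly to the standard normal density at rate O(N^{−1/2}). -/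

import Mathlib

open MeasureTheory Filter

noncomputable section

/-- Normalizing constant `c(λ) = ∫₀¹ e^{−λx − β/x} dx`. -/
def cpart (β l : ℝ) : ℝ := ∫ x in (0:ℝ)..1, Real.exp (-(l * x) - β / x)

/-- Single-particle mean `m(λ)`. -/
def mpart (β l : ℝ) : ℝ :=
  (∫ x in (0:ℝ)..1, x * Real.exp (-(l * x) - β / x)) / cpart β l

/-- Single-particle variance `v(λ)`. -/
def vpart (β l : ℝ) : ℝ :=
  (∫ x in (0:ℝ)..1, x ^ 2 * Real.exp (-(l * x) - β / x)) / cpart β l - mpart β l ^ 2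

/-- Density on `ℝ` of the single particle with parameter `l`: `e^{−lx − β/x}/c(l)` on `(0,1)`. -/
def partDensity (β l : ℝ) : ℝ → ℝ :=
  fun x => if 0 < x ∧ x < 1 then Real.exp (-(l * x) - β / x) / cpart β l else 0

/-- Convolution of densities on `ℝ`. -/
def conv (f g : ℝ → ℝ) : ℝ → ℝ := fun x => ∫ y : ℝ, f y * g (x - y)

/-- Density of the sum of independent particles with the given list of parameters. -/
def sumDensity (β : ℝ) : List ℝ → ℝ → ℝ
  | [] => fun _ => 0
  | [l] => partDensity β l
  | l :: rest => conv (partDensity β l) (sumDensity β rest)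

/-- characteristic function of a density -/
def cfun (f : ℝ → ℝ) (t : ℝ) : ℂ := ∫ x : ℝ, (f x : ℂ) * Complex.exp (Complex.I * t * x)

/-- regularity class of densities -/
structure Nice (f : ℝ → ℝ) : Prop where
  int : Integrable f
  meas : Measurable f
  bdd : ∃ M : ℝ, ∀ x, |f x| ≤ M
  aec : ∀ᵐ x : ℝ, ContinuousAt f x

lemma conv_continuous {f g : ℝ → ℝ} (hf : Nice f) (hg : Nice g) : Continuous (conv f g) := by
  obtain ⟨M, hM⟩ := hg.bdd
  rw [continuous_iff_continuousAt]
  intro x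
  unfold conv
  apply continuousAt_of_dominated (bound := fun y => |f y| * M)
  · filter_upwards with z
    exact (hf.meas.mul (hg.meas.comp (measurable_const.sub measurable_id))).aestronglyMeasurable
  · filter_upwards with z
    filter_upwards with y
    rw [norm_mul, Real.norm_eq_abs, Real.norm_eq_abs]
    exact mul_le_mul_of_nonneg_left (hM _) (abs_nonneg _)
  · exact hf.int.abs.mul_const M
  · have h1 : ∀ᵐ y : ℝ, ContinuousAt g (x - y) :=
      (quasiMeasurePreserving_sub_left volume x).ae hg.aec
    filter_upwards [h1] with y hy
    apply ContinuousAt.mul continuousAt_const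
    have : ContinuousAt (fun z : ℝ => z - y) x := by fun_prop
    exact ContinuousAt.comp (f := fun z : ℝ => z - y) (g := g) hy this

lemma conv_nice {f g : ℝ → ℝ} (hf : Nice f) (hg : Nice g) : Nice (conv f g) := by
  have hc := conv_continuous hf hg
  obtain ⟨M, hM⟩ := hg.bdd
  refine ⟨?_, hc.measurable, ⟨(∫ y, |f y| * M), fun x => ?_⟩, ?_⟩
  · have := hf.int.integrable_convolution (ContinuousLinearMap.mul ℝ ℝ) hg.int
    exact this
  · unfold conv
    rw [← Real.norm_eq_abs]
    apply norm_integral_le_of_norm_le (hf.int.abs.mul_const M)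
    filter_upwards with y
    rw [norm_mul, Real.norm_eq_abs, Real.norm_eq_abs]
    exact mul_le_mul_of_nonneg_left (hM _) (abs_nonneg _)
  · filter_upwards with x using hc.continuousAt

lemma integrable_mul_cexp {f : ℝ → ℝ} (hf : Integrable f) (t : ℝ) :
    Integrable (fun x : ℝ => (f x : ℂ) * Complex.exp (Complex.I * t * x)) := by
  have h := hf.ofReal (𝕜 := ℂ)
  refine h.mul_bdd (c := 1) ?_ ?_
  · apply Continuous.aestronglyMeasurable; fun_prop
  · filter_upwards with x
    rw [Complex.norm_exp]; simp

lemma cfun_conv {f g : ℝ → ℝ} (hf : Nice f) (hg : Nice g) (t : ℝ) :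
    cfun (conv f g) t = cfun f t * cfun g t := by
  have h1 := integral_convolution (ContinuousLinearMap.mul ℝ ℂ)
    (integrable_mul_cexp hf.int t) (integrable_mul_cexp hg.int t)
  simp only [ContinuousLinearMap.mul_apply'] at h1
  unfold cfun
  rw [← h1]
  congr 1
  ext x
  unfold convolution conv
  simp only [ContinuousLinearMap.mul_apply']
  rw [← integral_complex_ofReal, ← integral_mul_const]
  congr 1
  ext y
  push_cast
  rw [show Complex.I * t * x = Complex.I * t * y + Complex.I * t * (x - y) by ring, Complex.exp_add]
  ring

lemma sumDensity_nice (β : ℝ) (h : ∀ l, Nice (partDensity β l)) :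
    ∀ L : List ℝ, L ≠ [] → Nice (sumDensity β L)
  | [], h0 => absurd rfl h0
  | [l], _ => h l
  | l :: m :: rest, _ => conv_nice (h l) (sumDensity_nice β h (m :: rest) (by simp))

lemma sumDensity_cont (β : ℝ) (h : ∀ l, Nice (partDensity β l)) :
    ∀ L : List ℝ, 2 ≤ L.length → Continuous (sumDensity β L)
  | [], h0 => by simp at h0
  | [l], h0 => by simp at h0
  | l :: m :: rest, _ => conv_continuous (h l) (sumDensity_nice β h (m :: rest) (by simp))

lemma sumDensity_cfun (β : ℝ) (h : ∀ l, Nice (partDensity β l)) (t : ℝ) :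
    ∀ L : List ℝ, L ≠ [] → cfun (sumDensity β L) t = (L.map (fun l => cfun (partDensity β l) t)).prod
  | [], h0 => absurd rfl h0
  | [l], _ => by simp [sumDensity]
  | l :: m :: rest, _ => by
    rw [List.map_cons, List.prod_cons, ← sumDensity_cfun β h t (m :: rest) (by simp)]
    exact cfun_conv (h l) (sumDensity_nice β h (m :: rest) (by simp)) t

open FourierTransform in
lemma fourier_inversion {f : ℝ → ℝ} (hf : Integrable f) (hc : Continuous f)
    (hi : Integrable (cfun f)) (y : ℝ) :
    (f y : ℂ) = (1 / (2 * Real.pi)) * ∫ t : ℝ, Complex.exp (-(Complex.I * t * y)) * cfun f t := by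
  have e1 : ∀ w : ℝ, 𝓕 (fun x : ℝ => (f x : ℂ)) w = cfun f (-2 * Real.pi * w) := by
    intro w
    rw [Real.fourier_eq']
    unfold cfun
    congr 1
    ext x
    simp only [smul_eq_mul, RCLike.inner_apply, conj_trivial]
    rw [mul_comm]
    congr 2
    push_cast
    ring
  have hpi : (-2 * Real.pi) ≠ 0 := by
    have := Real.pi_pos; simp [this.ne']
  have hF : Integrable (𝓕 (fun x : ℝ => (f x : ℂ))) := by
    have : 𝓕 (fun x : ℝ => (f x : ℂ)) = fun w => cfun f (-2 * Real.pi * w) := funext e1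
    rw [this]
    exact hi.comp_mul_left' hpi
  have h := (hf.ofReal (𝕜 := ℂ)).fourierInv_fourier_eq (v := y) hF
    (Complex.continuous_ofReal.comp hc).continuousAt
  change _ = (f y : ℂ) at h
  rw [← h, Real.fourierInv_eq']
  have h2 := Measure.integral_comp_mul_left
    (fun t : ℝ => Complex.exp (-(Complex.I * t * y)) * cfun f t) (-2 * Real.pi)
  have h3 : (|(-2 * Real.pi)⁻¹|) = 1 / (2 * Real.pi) := by
    rw [abs_inv, abs_mul, abs_of_pos Real.pi_pos]; norm_num
  rw [h3] at h2
  have h4 : (1 / (2 * (Real.pi:ℂ))) = ((1 / (2 * Real.pi) : ℝ) : ℂ) := by push_cast; rfl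
  rw [h4, ← Complex.real_smul, ← h2]
  congr 1
  ext w
  erw [e1 w]
  simp only [smul_eq_mul, RCLike.inner_apply, conj_trivial]
  congr 2
  push_cast
  ring

lemma prod_sub_prod_bound (a b : ℕ → ℂ) (r d : ℝ) (hr : 0 ≤ r) (n : ℕ)
    (ha : ∀ k < n + 1, ‖a k‖ ≤ r) (hb : ∀ k < n + 1, ‖b k‖ ≤ r)
    (hd : ∀ k < n + 1, ‖a k - b k‖ ≤ d) :
    ‖∏ k ∈ Finset.range (n + 1), a k - ∏ k ∈ Finset.range (n + 1), b k‖ ≤ (n + 1) * d * r ^ n := by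
  induction n with
  | zero => simpa using hd 0 (by norm_num)
  | succ n ih =>
    have ih' := ih (fun k hk => ha k (by omega)) (fun k hk => hb k (by omega))
      (fun k hk => hd k (by omega))
    rw [Finset.prod_range_succ, Finset.prod_range_succ _ (n + 1)]
    have hB : ‖∏ k ∈ Finset.range (n + 1), b k‖ ≤ r ^ (n + 1) := by
      rw [norm_prod]
      calc _ ≤ ∏ k ∈ Finset.range (n + 1), r := by
            apply Finset.prod_le_prod (fun _ _ => norm_nonneg _)
            intro k hk
            exact hb k (by simp at hk; omega)
        _ = _ := by simp
    have e : (∏ k ∈ Finset.range (n + 1), a k) * a (n + 1) - (∏ k ∈ Finset.range (n + 1), b k) * b (n + 1)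
        = (∏ k ∈ Finset.range (n + 1), a k - ∏ k ∈ Finset.range (n + 1), b k) * a (n + 1)
          + (∏ k ∈ Finset.range (n + 1), b k) * (a (n + 1) - b (n + 1)) := by ring
    rw [e]
    have h0 : 0 ≤ d := (norm_nonneg _).trans (hd 0 (by omega))
    calc _ ≤ ‖∏ k ∈ Finset.range (n + 1), a k - ∏ k ∈ Finset.range (n + 1), b k‖ * ‖a (n + 1)‖
          + ‖∏ k ∈ Finset.range (n + 1), b k‖ * ‖a (n + 1) - b (n + 1)‖ := by
            refine (norm_add_le _ _).trans ?_
            rw [norm_mul, norm_mul]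
      _ ≤ ((n + 1) * d * r ^ n) * r + r ^ (n + 1) * d := by
            gcongr
            · exact ha _ (by omega)
            · exact hd _ (by omega)
      _ = _ := by push_cast; ring

lemma poly_exp_bound (b : ℝ) (hb : 0 < b) (y : ℝ) (hy : 0 ≤ y) :
    (y ^ 3 * (1 + y ^ 2)) * Real.exp (-(b * y ^ 2)) ≤ 2 + 12 / b ^ 3 ∧
    (y * (1 + y ^ 2)) * Real.exp (-(b * y ^ 2)) ≤ 2 + 12 / b ^ 3 := by
  have h1 : (b * y ^ 2) ^ 3 / 6 ≤ Real.exp (b * y ^ 2) := by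
    have := Real.pow_div_factorial_le_exp (b * y ^ 2) (by positivity) 3
    simpa [Nat.factorial] using this
  have h2 : 1 ≤ Real.exp (b * y ^ 2) := Real.one_le_exp (by positivity)
  have h3 : 2 + 2 * y ^ 6 ≤ (2 + 12 / b ^ 3) * Real.exp (b * y ^ 2) := by
    have : 2 * y ^ 6 = 12 / b ^ 3 * ((b * y ^ 2) ^ 3 / 6) := by field_simp; ring
    rw [this, add_mul]
    have h4 : 0 ≤ 12 / b ^ 3 := by positivity
    have := mul_le_mul_of_nonneg_left h1 h4
    linarith
  have hle : ∀ p : ℝ, p ≤ 2 + 2 * y ^ 6 → p * Real.exp (-(b * y ^ 2)) ≤ 2 + 12 / b ^ 3 := by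
    intro p hp
    rw [Real.exp_neg, ← div_eq_mul_inv, div_le_iff₀ (Real.exp_pos _)]
    exact hp.trans h3
  have hc : ∀ j : ℕ, j ≤ 6 → y ^ j ≤ 1 + y ^ 6 := by
    intro j hj
    rcases le_total y 1 with h | h
    · have := pow_le_one₀ (n := j) hy h
      have : 0 ≤ y ^ 6 := by positivity
      linarith
    · have := pow_le_pow_right₀ h hj
      linarith
  constructor
  · apply hle
    have := hc 3 (by norm_num); have := hc 5 (by norm_num)
    nlinarith
  · apply hle
    have := hc 3 (by norm_num); have := hc 1 (by norm_num)
    nlinarith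

lemma exp_sub_lin (x : ℝ) (hx : 0 ≤ x) : |Real.exp (-x) - (1 - x)| ≤ x ^ 2 := by
  have h1 : 1 - x ≤ Real.exp (-x) := by linarith [Real.add_one_le_exp (-x)]
  rw [abs_of_nonneg (by linarith)]
  have h2 : Real.exp (-x) ≤ 1 / (1 + x) := by
    rw [Real.exp_neg, ← one_div]
    apply one_div_le_one_div_of_le (by linarith)
    linarith [Real.add_one_le_exp x]
  have h3 : 1 / (1 + x) ≤ 1 - x + x ^ 2 := by
    rw [div_le_iff₀ (by linarith)]
    nlinarith [pow_nonneg hx 3]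
  linarith

lemma prod_bound (c C : ℝ) (hc : 0 < c) (hC : 0 < C) : ∃ K > 0, ∀ N : ℕ, 2 ≤ N →
    ∀ (ψ : ℕ → ℂ) (v : ℕ → ℝ) (u : ℝ),
    (∀ k < N, c ≤ v k ∧ v k ≤ C ∧ ‖ψ k‖ ≤ Real.exp (-(c * min 1 (u ^ 2))) ∧
      ‖ψ k - (1 - ((v k * u ^ 2 / 2 : ℝ) : ℂ))‖ ≤ C * |u| ^ 3 ∧ ‖ψ k‖ * |u| ≤ C) →
    ‖∏ k ∈ Finset.range N, ψ k -
      ((Real.exp (-((∑ k ∈ Finset.range N, v k) * u ^ 2 / 2)) : ℝ) : ℂ)‖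
      ≤ K / Real.sqrt N * (1 + N * u ^ 2)⁻¹ := by
  set A := (C + C ^ 2) * (2 + 12 / (c / 4) ^ 3) with hA
  set B := 2 * C ^ 2 * (8 + 4 / c ^ 2) + (2 + 12 / (c / 2) ^ 3) with hB
  have hApos : 0 < A := by positivity
  have hBpos : 0 < B := by positivity
  refine ⟨A + B, by positivity, ?_⟩
  intro N hN ψ v u H
  have hNpos : (0:ℝ) < N := by exact_mod_cast (by omega : 0 < N)
  have hN2 : (2:ℝ) ≤ N := by exact_mod_cast hN
  set q := Real.sqrt N with hq
  have hqpos : 0 < q := Real.sqrt_pos.mpr hNpos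
  have hq2 : q ^ 2 = N := Real.sq_sqrt hNpos.le
  set y := q * |u| with hy
  have hy0 : 0 ≤ y := by positivity
  have hy2 : y ^ 2 = N * u ^ 2 := by rw [hy, mul_pow, hq2, sq_abs]
  rw [← hy2, ← div_eq_mul_inv, le_div_iff₀ (by positivity), le_div_iff₀ hqpos]
  rcases le_or_gt |u| 1 with hu | hu
  · have hu2 : u ^ 2 ≤ 1 := by rw [← sq_abs]; exact pow_le_one₀ (abs_nonneg _) hu
    obtain ⟨n, rfl⟩ : ∃ n, N = n + 1 := ⟨N - 1, by omega⟩
    set b : ℕ → ℂ := fun k => ((Real.exp (-(v k * u ^ 2 / 2)) : ℝ) : ℂ) with hb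
    have hbp : ((Real.exp (-((∑ k ∈ Finset.range (n + 1), v k) * u ^ 2 / 2)) : ℝ) : ℂ)
        = ∏ k ∈ Finset.range (n + 1), b k := by
      rw [hb, ← Complex.ofReal_prod, ← Real.exp_sum, Finset.sum_neg_distrib, ← Finset.sum_div,
        ← Finset.sum_mul]
    rw [hbp]
    have hmain := prod_sub_prod_bound ψ b (Real.exp (-(c / 2 * u ^ 2))) ((C + C ^ 2) * |u| ^ 3)
      (Real.exp_pos _).le n ?_ ?_ ?_
    · have e1 : Real.exp (-(c / 2 * u ^ 2)) ^ n ≤ Real.exp (-(c / 4 * y ^ 2)) := by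
        rw [← Real.exp_nat_mul]
        apply Real.exp_le_exp.mpr
        rw [hy2]
        push_cast at hN2 ⊢
        have : 0 ≤ c * u ^ 2 := by positivity
        nlinarith
      have e2 := (poly_exp_bound (c / 4) (by positivity) y hy0).1
      calc _ ≤ ((n + 1) * ((C + C ^ 2) * |u| ^ 3) * Real.exp (-(c / 4 * y ^ 2))) * (1 + y ^ 2) * q := by
            gcongr
            refine hmain.trans ?_
            gcongr
        _ = (C + C ^ 2) * (y ^ 3 * (1 + y ^ 2) * Real.exp (-(c / 4 * y ^ 2))) := by
            have : (n + 1 : ℝ) = q ^ 2 := by rw [hq2]; push_cast; rfl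
            rw [this, hy]; ring
        _ ≤ A := by rw [hA]; gcongr
        _ ≤ A + B := by linarith
    · intro k hk
      refine (H k hk).2.2.1.trans (Real.exp_le_exp.mpr ?_)
      rw [min_eq_right hu2]
      have : 0 ≤ c * u ^ 2 := by positivity
      linarith
    · intro k hk
      rw [hb, Complex.norm_real, Real.norm_eq_abs, Real.abs_exp]
      apply Real.exp_le_exp.mpr
      have := mul_le_mul_of_nonneg_right (H k hk).1 (sq_nonneg u)
      linarith
    · intro k hk
      obtain ⟨h1, h2, h3, h4, h5⟩ := H k hk
      have e3 : ‖(1 - ((v k * u ^ 2 / 2 : ℝ) : ℂ)) - b k‖ ≤ C ^ 2 * |u| ^ 3 := by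
        have e4 : (1 - ((v k * u ^ 2 / 2 : ℝ) : ℂ)) - b k
          = ((1 - v k * u ^ 2 / 2 - Real.exp (-(v k * u ^ 2 / 2)) : ℝ) : ℂ) := by
          rw [hb]; push_cast; ring
        rw [e4, Complex.norm_real, Real.norm_eq_abs, abs_sub_comm]
        have hv0 : 0 ≤ v k := by linarith
        refine (exp_sub_lin _ (by positivity)).trans ?_
        have : (v k * u ^ 2 / 2) ^ 2 = v k ^ 2 / 4 * (|u| ^ 3 * |u|) := by
          rw [show |u| ^ 3 * |u| = (|u| ^ 2) ^ 2 by ring, sq_abs]; ring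
        rw [this]
        have h7 : |u| ^ 3 * |u| ≤ |u| ^ 3 * 1 := by gcongr
        have h8 : v k ^ 2 / 4 ≤ C ^ 2 := by nlinarith
        calc _ ≤ C ^ 2 * (|u| ^ 3 * 1) := by gcongr
          _ = _ := by ring
      calc ‖ψ k - b k‖ = ‖(ψ k - (1 - ((v k * u ^ 2 / 2 : ℝ) : ℂ))) + ((1 - ((v k * u ^ 2 / 2 : ℝ) : ℂ)) - b k)‖ := by
            congr 1; ring
        _ ≤ _ := norm_add_le _ _
        _ ≤ C * |u| ^ 3 + C ^ 2 * |u| ^ 3 := add_le_add h4 e3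
        _ = _ := by ring
  · have hu0 : 0 < |u| := by linarith
    have hu2 : 1 ≤ u ^ 2 := by rw [← sq_abs]; exact one_le_pow₀ hu.le
    have hqy : q ≤ y := by rw [hy]; nlinarith
    have g1 : Real.exp (-((∑ k ∈ Finset.range N, v k) * u ^ 2 / 2)) * (1 + y ^ 2) * q
        ≤ 2 + 12 / (c / 2) ^ 3 := by
      refine le_trans ?_ (poly_exp_bound (c / 2) (by positivity) y hy0).2
      have : Real.exp (-((∑ k ∈ Finset.range N, v k) * u ^ 2 / 2)) ≤ Real.exp (-(c / 2 * y ^ 2)) := by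
        apply Real.exp_le_exp.mpr
        rw [hy2]
        have h1 : N * c ≤ ∑ k ∈ Finset.range N, v k := by
          have := Finset.card_nsmul_le_sum (Finset.range N) v c
            (fun k hk => (H k (Finset.mem_range.mp hk)).1)
          simpa using this
        have := mul_le_mul_of_nonneg_right h1 (sq_nonneg u)
        nlinarith
      calc _ ≤ Real.exp (-(c / 2 * y ^ 2)) * (1 + y ^ 2) * y := by gcongr
        _ = _ := by ring
    have g2 : ‖∏ k ∈ Finset.range N, ψ k‖ * (1 + y ^ 2) * q ≤ 2 * C ^ 2 * (8 + 4 / c ^ 2) := by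
      obtain ⟨n, rfl⟩ : ∃ n, N = n + 2 := ⟨N - 2, by omega⟩
      have h1 : ‖∏ k ∈ Finset.range n, ψ k‖ ≤ Real.exp (-(c * n)) := by
        rw [norm_prod]
        calc _ ≤ ∏ k ∈ Finset.range n, Real.exp (-c) := by
              apply Finset.prod_le_prod (fun _ _ => norm_nonneg _)
              intro k hk
              have := (H k (by simp at hk; omega)).2.2.1
              rwa [min_eq_left hu2, mul_one] at this
          _ = _ := by simp [← Real.exp_nat_mul, mul_comm]
      have h2 : ∀ k < n + 2, ‖ψ k‖ ≤ C / |u| := by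
        intro k hk
        rw [le_div_iff₀ hu0]
        exact (H k hk).2.2.2.2
      rw [Finset.prod_range_succ, Finset.prod_range_succ, norm_mul, norm_mul]
      have h3 : 1 + y ^ 2 ≤ 2 * ((n + 2 : ℕ) * u ^ 2) := by
        rw [hy2]
        nlinarith
      have h4 : q ≤ (n + 2 : ℕ) := by
        rw [← hq2]
        have : 1 ≤ q := by rw [hq]; exact Real.one_le_sqrt.mpr (by linarith)
        nlinarith
      have h5 : ((n + 2 : ℕ) : ℝ) ^ 2 ≤ (8 + 4 / c ^ 2) * Real.exp (c * n) := by
        have f1 : (c * n) ^ 2 / 2 ≤ Real.exp (c * n) := by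
          have := Real.pow_div_factorial_le_exp (c * n) (by positivity) 2
          simpa [Nat.factorial] using this
        have f2 : 1 ≤ Real.exp (c * n) := Real.one_le_exp (by positivity)
        have f3 : 4 / c ^ 2 * ((c * n) ^ 2 / 2) = 2 * (n:ℝ) ^ 2 := by field_simp; ring
        have f4 := mul_le_mul_of_nonneg_left f1 (by positivity : 0 ≤ 4 / c ^ 2)
        push_cast
        nlinarith [sq_nonneg ((n:ℝ) - 2)]
      have h6 : Real.exp (-(c * n)) * ((n + 2 : ℕ) : ℝ) ^ 2 ≤ 8 + 4 / c ^ 2 := by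
        rw [Real.exp_neg, mul_comm, ← div_eq_mul_inv, div_le_iff₀ (Real.exp_pos _)]
        exact h5
      calc _ ≤ (Real.exp (-(c * n)) * (C / |u|) * (C / |u|)) * (2 * ((n + 2 : ℕ) * u ^ 2)) * (n + 2 : ℕ) := by
            gcongr
            · exact h2 _ (by omega)
            · exact h2 _ (by omega)
        _ = 2 * C ^ 2 * (Real.exp (-(c * n)) * ((n + 2 : ℕ) : ℝ) ^ 2) := by
            rw [← sq_abs u]; field_simp
        _ ≤ _ := by gcongr
    calc _ ≤ (‖∏ k ∈ Finset.range N, ψ k‖ + Real.exp (-((∑ k ∈ Finset.range N, v k) * u ^ 2 / 2))) * (1 + y ^ 2) * q := by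
          gcongr
          refine (norm_sub_le _ _).trans ?_
          rw [Complex.norm_real, Real.norm_eq_abs, Real.abs_exp]
      _ ≤ B := by rw [hB]; linarith
      _ ≤ _ := by linarith

lemma abs_sin_le_sinc (y : ℝ) : |Real.sin y| ≤ |y| * (1 - 1 / 20 * min 1 (y ^ 2)) := by
  wlog hy : 0 ≤ y generalizing y with H
  · have := H (-y) (by linarith)
    simpa using this
  rw [abs_of_nonneg hy]
  rcases le_or_gt y 1 with h1 | h1
  · have hy2 : y ^ 2 ≤ 1 := pow_le_one₀ hy h1
    rw [min_eq_right hy2]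
    have h2 := Real.sin_bound (x := y) (by rw [abs_of_nonneg hy]; exact h1)
    rw [abs_of_nonneg hy, abs_le] at h2
    have h3 : 0 ≤ Real.sin y := Real.sin_nonneg_of_nonneg_of_le_pi hy (by linarith [Real.pi_gt_three])
    rw [abs_of_nonneg h3]
    nlinarith [pow_nonneg hy 3, mul_le_mul_of_nonneg_left h1 (pow_nonneg hy 3)]
  · have hy2 : 1 ≤ y ^ 2 := one_le_pow₀ h1.le
    rw [min_eq_left hy2]
    rcases le_or_gt 2 y with h2 | h2
    · have := Real.abs_sin_le_one y
      linarith
    · have h3 := Real.sin_bound (x := 1) (by simp)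
      rw [abs_le] at h3
      norm_num at h3
      have h5 : |Real.sin y - Real.sin 1| ≤ |y - 1| := by
        have := Real.lipschitzWith_sin.dist_le_mul y 1
        simpa [Real.dist_eq] using this
      rw [abs_of_pos (by linarith : 0 < y - 1)] at h5
      have h6 : 0 ≤ Real.sin y := Real.sin_nonneg_of_nonneg_of_le_pi hy (by linarith [Real.pi_gt_three])
      rw [abs_of_nonneg h6]
      have := (abs_le.mp h5).2
      linarith

lemma norm_window (s η t : ℝ) (hη : 0 < η) :
    ‖∫ x in (s - η)..(s + η), Complex.exp (Complex.I * t * x)‖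
      ≤ 2 * η * (1 - 1 / 20 * min 1 ((η * t) ^ 2)) := by
  rcases eq_or_ne t 0 with rfl | ht
  · simp
    rw [← Complex.ofReal_add, Complex.norm_real,
      Real.norm_eq_abs, abs_of_nonneg (by linarith)]
    linarith
  · have hne : Complex.I * (t:ℂ) ≠ 0 := by simp [ht]
    rw [integral_exp_mul_complex hne]
    have e : Complex.exp (Complex.I * t * ((s + η : ℝ) : ℂ)) - Complex.exp (Complex.I * t * ((s - η : ℝ) : ℂ))
        = Complex.exp (Complex.I * t * s) * (2 * Complex.I * ((Real.sin (η * t) : ℝ) : ℂ)) := by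
      push_cast
      rw [Complex.sin, show Complex.I * t * (s + η) = Complex.I * t * s + (η * t) * Complex.I by ring,
        show Complex.I * t * (s - η) = Complex.I * t * s + (-(η * t)) * Complex.I by ring,
        Complex.exp_add, Complex.exp_add]
      have hI := Complex.I_mul_I
      linear_combination (Complex.exp (Complex.I * t * s) * (Complex.exp (-(η * t) * Complex.I) - Complex.exp ((η * t) * Complex.I))) * (-hI)
    rw [e, norm_div, norm_mul, norm_mul, norm_mul, norm_mul, Complex.norm_exp, Complex.norm_real,
      Complex.norm_real, Complex.norm_I, Real.norm_eq_abs, Real.norm_eq_abs]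
    have h := abs_sin_le_sinc (η * t)
    rw [abs_mul, abs_of_pos hη] at h
    have ht' : 0 < |t| := abs_pos.mpr ht
    rw [div_le_iff₀ (by positivity)]
    have : Real.exp (Complex.I * t * s).re = 1 := by simp
    rw [this]
    simp
    nlinarith

/-- quantitative concentration data for a density -/
structure Core (f : ℝ → ℝ) (s η c0 C0 : ℝ) : Prop where
  nice : Nice f
  nonneg : ∀ x, 0 ≤ f x
  one : ∫ x, f x = 1
  lower : ∀ x, |x - s| ≤ η → c0 / η ≤ f x
  momI : ∀ j ≤ 3, Integrable (fun x => |x - s| ^ j * f x)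
  mom : ∀ j ≤ 3, ∫ x, |x - s| ^ j * f x ≤ C0 * η ^ j
  dec : ∀ t : ℝ, ‖cfun f t‖ * |t| ≤ C0 / η

lemma core_cfun {f : ℝ → ℝ} {s η c0 C0 : ℝ} (h : Core f s η c0 C0) (hη : 0 < η) (hc0 : 0 < c0)
    (t : ℝ) : ‖cfun f t‖ ≤ Real.exp (-(c0 / 10 * min 1 ((η * t) ^ 2))) := by
  set I := Set.Ioc (s - η) (s + η) with hI
  set g : ℝ → ℝ := I.indicator (fun _ => c0 / η) with hg
  have hgI : Integrable g := by
    rw [hg, integrable_indicator_iff measurableSet_Ioc]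
    exact integrableOn_const (by simp)
  have hgf : ∀ x, g x ≤ f x := by
    intro x
    rw [hg, Set.indicator_apply]
    split_ifs with hx
    · exact h.lower x (by rw [abs_le]; rcases hx with ⟨h1, h2⟩; constructor <;> linarith)
    · exact h.nonneg x
  have hgint : ∫ x, g x = 2 * c0 := by
    rw [hg, integral_indicator measurableSet_Ioc, setIntegral_const]
    simp [Measure.real]
    rw [ENNReal.toReal_ofReal (by linarith)]
    field_simp; ring
  have e1 : cfun f t = cfun (fun x => f x - g x) t + cfun g t := by
    unfold cfun
    have j1 : Integrable (fun x : ℝ => ((f x - g x : ℝ) : ℂ) * Complex.exp (Complex.I * t * x)) :=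
      integrable_mul_cexp (h.nice.int.sub hgI) t
    rw [← integral_add j1 (integrable_mul_cexp hgI t)]
    congr 1; ext x; push_cast; ring
  have e2 : ‖cfun (fun x => f x - g x) t‖ ≤ 1 - 2 * c0 := by
    unfold cfun
    rw [← hgint, ← h.one, ← integral_sub h.nice.int hgI]
    apply norm_integral_le_of_norm_le (h.nice.int.sub hgI)
    filter_upwards with x
    rw [norm_mul, Complex.norm_real, Complex.norm_exp, Real.norm_eq_abs,
      abs_of_nonneg (by linarith [hgf x])]
    simp
  have e3 : ‖cfun g t‖ ≤ 2 * c0 * (1 - 1 / 20 * min 1 ((η * t) ^ 2)) := by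
    have : cfun g t = ((c0 / η : ℝ) : ℂ) * ∫ x in (s - η)..(s + η), Complex.exp (Complex.I * t * x) := by
      unfold cfun
      rw [intervalIntegral.integral_of_le (by linarith), ← integral_indicator measurableSet_Ioc,
        ← integral_const_mul]
      congr 1; ext x
      simp only [hg, hI, Set.indicator_apply]
      split_ifs <;> simp
    rw [this, norm_mul, Complex.norm_real, Real.norm_eq_abs, abs_of_pos (by positivity)]
    calc _ ≤ c0 / η * (2 * η * (1 - 1 / 20 * min 1 ((η * t) ^ 2))) := by
          gcongr; exact norm_window s η t hη
      _ = _ := by field_simp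
  calc _ ≤ 1 - 2 * c0 + 2 * c0 * (1 - 1 / 20 * min 1 ((η * t) ^ 2)) := by
        rw [e1]; exact (norm_add_le _ _).trans (add_le_add e2 e3)
    _ = -(c0 / 10 * min 1 ((η * t) ^ 2)) + 1 := by ring
    _ ≤ _ := Real.add_one_le_exp _

section moments
variable {f : ℝ → ℝ} {s η c0 C0 : ℝ}

lemma core_int1 (h : Core f s η c0 C0) : Integrable (fun x => (x - s) * f x) := by
  refine (h.momI 1 (by norm_num)).mono' ?_ ?_
  · exact ((measurable_id.sub_const s).mul h.nice.meas).aestronglyMeasurable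
  · filter_upwards with x
    rw [norm_mul, Real.norm_eq_abs, Real.norm_eq_abs, abs_of_nonneg (h.nonneg x), pow_one]

lemma core_int2 (h : Core f s η c0 C0) : Integrable (fun x => (x - s) ^ 2 * f x) := by
  simpa [sq_abs] using h.momI 2 (by norm_num)

lemma core_xint (h : Core f s η c0 C0) : Integrable (fun x => x * f x) := by
  have := (core_int1 h).add (h.nice.int.const_mul s)
  refine this.congr ?_
  filter_upwards with x
  simp; ring

lemma core_x2int (h : Core f s η c0 C0) : Integrable (fun x => x ^ 2 * f x) := by
  have := ((core_int2 h).add ((core_xint h).const_mul (2 * s))).sub (h.nice.int.const_mul (s ^ 2))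
  refine this.congr ?_
  filter_upwards with x
  simp; ring

lemma core_mean (h : Core f s η c0 C0) :
    |(∫ x, x * f x) - s| ≤ C0 * η := by
  have e : (∫ x, x * f x) - s = ∫ x, (x - s) * f x := by
    have : (fun x => (x - s) * f x) = fun x => x * f x - s * f x := by ext x; ring
    rw [this, integral_sub (core_xint h) (h.nice.int.const_mul s), integral_const_mul, h.one]
    ring
  rw [e, ← Real.norm_eq_abs]
  have h1 := h.mom 1 (by norm_num)
  rw [pow_one] at h1
  refine (norm_integral_le_of_norm_le (h.momI 1 (by norm_num)) ?_).trans h1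
  filter_upwards with x
  rw [norm_mul, Real.norm_eq_abs, Real.norm_eq_abs, abs_of_nonneg (h.nonneg x), pow_one]

lemma core_quad (h : Core f s η c0 C0) (a : ℝ) :
    Integrable (fun x => (x - a) ^ 2 * f x) ∧
    ∫ x, (x - a) ^ 2 * f x = (∫ x, x ^ 2 * f x) - 2 * a * (∫ x, x * f x) + a ^ 2 := by
  have e : (fun x => (x - a) ^ 2 * f x) = fun x => x ^ 2 * f x - 2 * a * (x * f x) + a ^ 2 * f x := by
    ext x; ring
  have i1 : Integrable (fun x => x ^ 2 * f x - 2 * a * (x * f x)) :=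
    (core_x2int h).sub ((core_xint h).const_mul (2 * a))
  constructor
  · rw [e]
    exact i1.add (h.nice.int.const_mul (a ^ 2))
  · rw [e, integral_add i1 (h.nice.int.const_mul (a ^ 2)),
      integral_sub (core_x2int h) ((core_xint h).const_mul (2 * a)), integral_const_mul,
      integral_const_mul, h.one, mul_one]

lemma core_var (h : Core f s η c0 C0) (hη : 0 < η) (hc0 : 0 < c0) (m v : ℝ)
    (hm : m = ∫ x, x * f x) (hv : v = (∫ x, x ^ 2 * f x) - m ^ 2) :
    c0 / 2 * η ^ 2 ≤ v ∧ v ≤ C0 * η ^ 2 := by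
  have q1 := (core_quad h m).2
  have q2 := (core_quad h s).2
  rw [← hm] at q1 q2
  have hv1 : v = ∫ x, (x - m) ^ 2 * f x := by rw [q1, hv]; ring
  have hv2 : v ≤ ∫ x, (x - s) ^ 2 * f x := by rw [q2, hv]; nlinarith [sq_nonneg (m - s)]
  constructor
  · rw [hv1]
    have e1 : ∫ x in (s - η)..(s + η), c0 / η * (x - m) ^ 2
        = c0 / η * (((s + η - m) ^ 3 - (s - η - m) ^ 3) / 3) := by
      rw [intervalIntegral.integral_const_mul,
        intervalIntegral.integral_comp_sub_right (fun x => x ^ 2), integral_pow]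
      norm_num
    have e2 : c0 / 2 * η ^ 2 ≤ c0 / η * (((s + η - m) ^ 3 - (s - η - m) ^ 3) / 3) := by
      have : c0 / η * (((s + η - m) ^ 3 - (s - η - m) ^ 3) / 3)
        = c0 * (2 / 3 * η ^ 2 + 2 * (s - m) ^ 2) := by field_simp; ring
      rw [this]
      nlinarith [mul_nonneg hc0.le (sq_nonneg (s - m)), mul_nonneg hc0.le (sq_nonneg η)]
    refine e2.trans ?_
    rw [← e1, intervalIntegral.integral_of_le (by linarith), ← integral_indicator measurableSet_Ioc]
    apply integral_mono
    · rw [integrable_indicator_iff measurableSet_Ioc]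
      apply (Continuous.integrableOn_Icc (by fun_prop)).mono_set Set.Ioc_subset_Icc_self
    · exact (core_quad h m).1
    · intro x
      simp only [Set.indicator_apply]
      split_ifs with hx
      · rw [mul_comm]
        exact mul_le_mul_of_nonneg_left (h.lower x (by
          rw [abs_le]; rcases hx with ⟨h1, h2⟩; constructor <;> linarith)) (sq_nonneg _)
      · exact mul_nonneg (sq_nonneg _) (h.nonneg x)
  · refine hv2.trans ?_
    simpa [sq_abs] using h.mom 2 (by norm_num)

lemma cexp_taylor (y : ℝ) :
    ‖Complex.exp (Complex.I * y) - 1 - Complex.I * y + (y:ℂ) ^ 2 / 2‖ ≤ 4 * |y| ^ 3 := by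
  rcases le_or_gt |y| 1 with h | h
  · have h1 := Complex.exp_bound (x := Complex.I * y) (by simpa using h) (n := 3) (by norm_num)
    simp [Finset.sum_range_succ, Nat.factorial] at h1
    have e : Complex.exp (Complex.I * y) - 1 - Complex.I * y + (y:ℂ) ^ 2 / 2
      = Complex.exp (Complex.I * y) - (1 + Complex.I * y + (Complex.I * y) ^ 2 / 2) := by
      rw [mul_pow, Complex.I_sq]; ring
    rw [e]
    refine h1.trans ?_
    nlinarith [pow_nonneg (abs_nonneg y) 3]
  · have n1 : ‖Complex.exp (Complex.I * y)‖ = 1 := by rw [Complex.norm_exp]; simp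
    have n2 : ‖Complex.I * (y:ℂ)‖ = |y| := by simp
    have n3 : ‖(y:ℂ) ^ 2 / 2‖ = |y| ^ 2 / 2 := by simp
    calc _ ≤ ‖Complex.exp (Complex.I * y)‖ + ‖(1:ℂ)‖ + ‖Complex.I * (y:ℂ)‖ + ‖(y:ℂ) ^ 2 / 2‖ :=
          (norm_add_le _ _).trans (add_le_add_left ((norm_sub_le _ _).trans
            (add_le_add_left (norm_sub_le _ _) _)) _)
      _ = 1 + 1 + |y| + |y| ^ 2 / 2 := by rw [n1, n2, n3, norm_one]
      _ ≤ _ := by nlinarith [pow_le_pow_right₀ h.le (by norm_num : 2 ≤ 3), one_le_pow₀ (n := 2) h.le]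

lemma core_taylor (h : Core f s η c0 C0) (hη : 0 < η) (hC0 : 0 < C0) (m v : ℝ)
    (hm : m = ∫ x, x * f x) (hv : v = (∫ x, x ^ 2 * f x) - m ^ 2) (t : ℝ) :
    ‖cfun f t * Complex.exp (-(Complex.I * t * m)) - (1 - ((v * t ^ 2 / 2 : ℝ) : ℂ))‖
      ≤ 16 * (C0 + C0 ^ 3) * (η * |t|) ^ 3 := by
  have i1 := integrable_mul_cexp h.nice.int t
  have q1 := core_quad h m
  rw [← hm] at q1
  have hv1 : v = ∫ x, (x - m) ^ 2 * f x := by rw [q1.2, hv]; ring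
  have hm1 : ∫ x, (x - m) * f x = 0 := by
    have : (fun x => (x - m) * f x) = fun x => x * f x - m * f x := by ext x; ring
    rw [this, integral_sub (core_xint h) (h.nice.int.const_mul m), integral_const_mul, h.one, ← hm]
    ring
  have im1 : Integrable (fun x => (x - m) * f x) := by
    have : (fun x => (x - m) * f x) = fun x => x * f x - m * f x := by ext x; ring
    rw [this]; exact (core_xint h).sub (h.nice.int.const_mul m)
  have key : cfun f t * Complex.exp (-(Complex.I * t * m)) - (1 - ((v * t ^ 2 / 2 : ℝ) : ℂ))
      = ∫ x : ℝ, (f x : ℂ) * (Complex.exp (Complex.I * ((t * (x - m) : ℝ) : ℂ)) - 1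
          - Complex.I * ((t * (x - m) : ℝ) : ℂ) + (((t * (x - m) : ℝ) : ℂ)) ^ 2 / 2) := by
    have e : ∀ x : ℝ, (f x : ℂ) * (Complex.exp (Complex.I * ((t * (x - m) : ℝ) : ℂ)) - 1
          - Complex.I * ((t * (x - m) : ℝ) : ℂ) + (((t * (x - m) : ℝ) : ℂ)) ^ 2 / 2)
        = ((f x : ℂ) * Complex.exp (Complex.I * t * x)) * Complex.exp (-(Complex.I * t * m))
          - ((f x : ℝ) : ℂ) - (Complex.I * t) * (((x - m) * f x : ℝ) : ℂ)
          + ((t:ℂ) ^ 2 / 2) * (((x - m) ^ 2 * f x : ℝ) : ℂ) := by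
      intro x
      have : Complex.exp (Complex.I * ((t * (x - m) : ℝ) : ℂ))
        = Complex.exp (Complex.I * t * x) * Complex.exp (-(Complex.I * t * m)) := by
        rw [← Complex.exp_add]; congr 1; push_cast; ring
      rw [this]; push_cast; ring
    simp_rw [e]
    have j1 := i1.mul_const (Complex.exp (-(Complex.I * t * m)))
    have j2 : Integrable (fun x : ℝ => ((f x : ℝ) : ℂ)) := h.nice.int.ofReal (𝕜 := ℂ)
    have j3 : Integrable (fun x : ℝ => (Complex.I * t) * (((x - m) * f x : ℝ) : ℂ)) := (im1.ofReal (𝕜 := ℂ)).const_mul (Complex.I * t)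
    have j4 : Integrable (fun x : ℝ => ((t:ℂ) ^ 2 / 2) * (((x - m) ^ 2 * f x : ℝ) : ℂ)) := (q1.1.ofReal (𝕜 := ℂ)).const_mul ((t:ℂ) ^ 2 / 2)
    have j12 : Integrable (fun x : ℝ => (f x : ℂ) * Complex.exp (Complex.I * t * x) *
      Complex.exp (-(Complex.I * t * m)) - ((f x : ℝ) : ℂ)) := j1.sub j2
    have j123 : Integrable (fun x : ℝ => (f x : ℂ) * Complex.exp (Complex.I * t * x) *
      Complex.exp (-(Complex.I * t * m)) - ((f x : ℝ) : ℂ)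
      - (Complex.I * t) * (((x - m) * f x : ℝ) : ℂ)) := j12.sub j3
    rw [integral_add j123 j4, integral_sub j12 j3, integral_sub j1 j2]
    rw [integral_mul_const]
    rw [integral_const_mul, integral_const_mul, integral_complex_ofReal, integral_complex_ofReal, integral_complex_ofReal]
    rw [hm1, ← hv1, h.one]
    unfold cfun
    push_cast
    ring
  rw [key]
  have hms := core_mean h
  rw [← hm] at hms
  have hb : Integrable (fun x => 16 * |t| ^ 3 * (|x - s| ^ 3 * f x) + 16 * |t| ^ 3 * (C0 * η) ^ 3 * f x) :=
    ((h.momI 3 le_rfl).const_mul _).add (h.nice.int.const_mul _)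
  refine (norm_integral_le_of_norm_le hb ?_).trans ?_
  · filter_upwards with x
    rw [norm_mul, Complex.norm_real, Real.norm_eq_abs, abs_of_nonneg (h.nonneg x)]
    have t1 := cexp_taylor (t * (x - m))
    have t2 : |x - m| ^ 3 ≤ 4 * (|x - s| ^ 3 + (C0 * η) ^ 3) := by
      have a1 : |x - m| ≤ |x - s| + C0 * η := by
        have := abs_sub_le x s m
        rw [abs_sub_comm s m] at this
        linarith
      have a2 : 0 ≤ |x - s| := abs_nonneg _
      have a3 : 0 ≤ C0 * η := by positivity
      calc _ ≤ (|x - s| + C0 * η) ^ 3 := by gcongr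
        _ ≤ _ := by nlinarith [mul_nonneg (add_nonneg a2 a3) (sq_nonneg (|x - s| - C0 * η))]
    rw [abs_mul, mul_pow] at t1
    calc _ ≤ f x * (4 * (|t| ^ 3 * |x - m| ^ 3)) := mul_le_mul_of_nonneg_left t1 (h.nonneg x)
      _ ≤ f x * (4 * (|t| ^ 3 * (4 * (|x - s| ^ 3 + (C0 * η) ^ 3)))) := by
          have := h.nonneg x
          gcongr
      _ = _ := by ring
  · rw [integral_add ((h.momI 3 le_rfl).const_mul _) (h.nice.int.const_mul _), integral_const_mul,
      integral_const_mul, h.one]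
    have := mul_le_mul_of_nonneg_left (h.mom 3 le_rfl) (by positivity : 0 ≤ 16 * |t| ^ 3)
    calc _ ≤ 16 * |t| ^ 3 * (C0 * η ^ 3) + 16 * |t| ^ 3 * (C0 * η) ^ 3 * 1 := by linarith
      _ = _ := by ring

end moments

/-- unnormalised weight -/
def wt (β l x : ℝ) : ℝ := Real.exp (-(l * x) - β / x)

lemma wt_pos (β l x : ℝ) : 0 < wt β l x := Real.exp_pos _

lemma wt_meas (β l : ℝ) : Measurable (wt β l) := by
  unfold wt; fun_prop

lemma wt_contAt (β l : ℝ) {x : ℝ} (hx : x ≠ 0) : ContinuousAt (wt β l) x := by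
  unfold wt; fun_prop (disch := assumption)

lemma wt_le (β l : ℝ) (hβ : 0 < β) {x : ℝ} (h0 : 0 < x) (h1 : x ≤ 1) :
    wt β l x ≤ Real.exp |l| := by
  unfold wt
  apply Real.exp_le_exp.mpr
  have : 0 < β / x := by positivity
  have h2 : -(l * x) ≤ |l| * x := by nlinarith [neg_abs_le l]
  have h3 : |l| * x ≤ |l| * 1 := by gcongr
  linarith

lemma wt_intOn (β l : ℝ) (hβ : 0 < β) : IntegrableOn (wt β l) (Set.Ioo 0 1) := by
  have hc : IntegrableOn (fun _ : ℝ => Real.exp |l|) (Set.Ioo 0 1) := integrableOn_const (by simp)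
  refine Integrable.mono' hc (wt_meas β l).aestronglyMeasurable ?_
  filter_upwards [ae_restrict_mem measurableSet_Ioo] with x hx
  rw [Real.norm_eq_abs, abs_of_pos (wt_pos _ _ _)]
  exact wt_le β l hβ hx.1 hx.2.le

lemma wt_iint (β l : ℝ) (hβ : 0 < β) : IntervalIntegrable (wt β l) volume 0 1 := by
  rw [intervalIntegrable_iff_integrableOn_Ioo_of_le zero_le_one]
  exact wt_intOn β l hβ

lemma cpart_pos (β l : ℝ) (hβ : 0 < β) : 0 < cpart β l :=
  intervalIntegral.intervalIntegral_pos_of_pos_on (wt_iint β l hβ)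
    (fun x _ => wt_pos β l x) zero_lt_one

lemma partDensity_eq (β l : ℝ) :
    partDensity β l = (Set.Ioo (0:ℝ) 1).indicator (fun x => wt β l x / cpart β l) := by
  ext x
  simp [partDensity, Set.indicator_apply, wt]

lemma partDensity_nonneg (β l : ℝ) (hβ : 0 < β) (x : ℝ) : 0 ≤ partDensity β l x := by
  rw [partDensity_eq]
  apply Set.indicator_nonneg
  intro x _
  exact div_nonneg (wt_pos _ _ _).le (cpart_pos β l hβ).le

lemma partDensity_nice (β : ℝ) (hβ : 0 < β) (l : ℝ) : Nice (partDensity β l) := by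
  refine ⟨?_, ?_, ⟨Real.exp |l| / cpart β l, fun x => ?_⟩, ?_⟩
  · rw [partDensity_eq, integrable_indicator_iff measurableSet_Ioo]
    exact (wt_intOn β l hβ).div_const _
  · rw [partDensity_eq]
    exact ((wt_meas β l).div_const _).indicator measurableSet_Ioo
  · rw [abs_of_nonneg (partDensity_nonneg β l hβ x), partDensity_eq, Set.indicator_apply]
    have := cpart_pos β l hβ
    split_ifs with hx
    · gcongr
      exact wt_le β l hβ hx.1 hx.2.le
    · positivity
  · have h01 : ∀ᵐ x : ℝ, x ≠ 0 ∧ x ≠ 1 := by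
      have h0 : ∀ᵐ x : ℝ, x ≠ 0 := by simp [ae_iff]
      have h1 : ∀ᵐ x : ℝ, x ≠ 1 := by simp [ae_iff]
      filter_upwards [h0, h1] with x a b using ⟨a, b⟩
    filter_upwards [h01] with x hx
    rw [partDensity_eq]
    by_cases hm : x ∈ Set.Ioo (0:ℝ) 1
    · have : (fun x => wt β l x / cpart β l) =ᶠ[nhds x]
          (Set.Ioo (0:ℝ) 1).indicator (fun x => wt β l x / cpart β l) := by
        filter_upwards [isOpen_Ioo.mem_nhds hm] with y hy
        rw [Set.indicator_of_mem hy]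
      exact ((wt_contAt β l hx.1).div_const _).congr this
    · have hm' : x ∈ (Set.Icc (0:ℝ) 1)ᶜ := by
        intro hI
        exact hm ⟨lt_of_le_of_ne hI.1 (Ne.symm hx.1), lt_of_le_of_ne hI.2 hx.2⟩
      have : (fun _ => (0:ℝ)) =ᶠ[nhds x]
          (Set.Ioo (0:ℝ) 1).indicator (fun x => wt β l x / cpart β l) := by
        filter_upwards [isClosed_Icc.isOpen_compl.mem_nhds hm'] with y hy
        rw [Set.indicator_of_notMem]
        exact fun h => hy ⟨h.1.le, h.2.le⟩
      exact continuousAt_const.congr this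

lemma int_part (β l : ℝ) (g : ℝ → ℝ) :
    ∫ x, g x * partDensity β l x = (∫ x in (0:ℝ)..1, g x * wt β l x) / cpart β l := by
  rw [intervalIntegral.integral_of_le zero_le_one, integral_Ioc_eq_integral_Ioo,
    ← integral_indicator measurableSet_Ioo, ← integral_div]
  congr 1; ext x
  rw [partDensity_eq]
  simp only [Set.indicator_apply]
  split_ifs
  · ring
  · simp

lemma int_part_one (β l : ℝ) (hβ : 0 < β) : ∫ x, partDensity β l x = 1 := by
  have h := int_part β l (fun _ => 1)
  simp only [one_mul] at h
  rw [h]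
  exact div_self (cpart_pos β l hβ).ne'

lemma mpart_eq (β l : ℝ) : mpart β l = ∫ x, x * partDensity β l x := by
  rw [int_part β l (fun x => x)]; rfl

lemma vpart_eq (β l : ℝ) : vpart β l = (∫ x, x ^ 2 * partDensity β l x) - mpart β l ^ 2 := by
  rw [int_part β l (fun x => x ^ 2)]; rfl

lemma ibp_mono (G G' : ℝ → ℝ) (a b W t : ℝ) (hab : a ≤ b)
    (hd : ∀ x ∈ Set.Icc a b, HasDerivAt G (G' x) x) (hc : ContinuousOn G' (Set.Icc a b))
    (hs : (∀ x ∈ Set.Icc a b, 0 ≤ G' x) ∨ (∀ x ∈ Set.Icc a b, G' x ≤ 0))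
    (h0 : ∀ x ∈ Set.Icc a b, 0 ≤ G x) (hW : ∀ x ∈ Set.Icc a b, G x ≤ W) :
    ‖∫ x in a..b, (G x : ℂ) * Complex.exp (Complex.I * t * x)‖ * |t| ≤ 2 * W := by
  have ha : a ∈ Set.Icc a b := ⟨le_rfl, hab⟩
  have hb : b ∈ Set.Icc a b := ⟨hab, le_rfl⟩
  rcases eq_or_ne t 0 with rfl | ht
  · simp; linarith [h0 a ha, hW a ha]
  have hu : Set.uIcc a b = Set.Icc a b := Set.uIcc_of_le hab
  have hcu : ContinuousOn G' (Set.uIcc a b) := by rwa [hu]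
  have hG'i : IntervalIntegrable G' volume a b := hcu.intervalIntegrable
  have hftc : ∫ x in a..b, G' x = G b - G a :=
    intervalIntegral.integral_eq_sub_of_hasDerivAt (fun x hx => hd x (by rwa [hu] at hx)) hG'i
  have habs : ∫ x in a..b, |G' x| = |G b - G a| := by
    rw [← hftc]
    rcases hs with hs | hs
    · rw [abs_of_nonneg (intervalIntegral.integral_nonneg hab hs)]
      apply intervalIntegral.integral_congr
      intro x hx
      rw [hu] at hx
      exact abs_of_nonneg (hs x hx)
    · have h1 : ∫ x in a..b, |G' x| = - ∫ x in a..b, G' x := by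
        rw [← intervalIntegral.integral_neg]
        apply intervalIntegral.integral_congr
        intro x hx
        rw [hu] at hx
        exact abs_of_nonpos (hs x hx)
      have h2 : 0 ≤ ∫ x in a..b, |G' x| := intervalIntegral.integral_nonneg hab (fun _ _ => abs_nonneg _)
      rw [h1, abs_of_nonpos (by linarith)]
  have hne : Complex.I * (t:ℂ) ≠ 0 := by simp [ht]
  set V : ℝ → ℂ := fun x => Complex.exp (Complex.I * t * x) / (Complex.I * t) with hV
  have hVd : ∀ x : ℝ, HasDerivAt V (Complex.exp (Complex.I * t * x)) x := by
    intro x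
    have h1 : HasDerivAt (fun x : ℝ => Complex.I * t * (x:ℂ)) (Complex.I * t * 1) x :=
      (Complex.ofRealCLM.hasDerivAt (x := x)).const_mul _
    have h2 := (h1.cexp).div_const (Complex.I * t)
    rw [mul_one, mul_div_assoc, div_self hne, mul_one] at h2
    exact h2
  have hVn : ∀ x : ℝ, ‖V x‖ = 1 / |t| := by
    intro x
    rw [hV]
    simp only [norm_div, Complex.norm_exp, norm_mul, Complex.norm_I, Complex.norm_real]
    simp
  have hibp := intervalIntegral.integral_mul_deriv_eq_deriv_mul (a := a) (b := b)
    (u := fun x => (G x : ℂ)) (u' := fun x => (G' x : ℂ)) (v := V)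
    (v' := fun x : ℝ => Complex.exp (Complex.I * t * x))
    (fun x hx => (hd x (by rwa [hu] at hx)).ofReal_comp) (fun x _ => hVd x)
    (by
      apply ContinuousOn.intervalIntegrable
      exact Complex.continuous_ofReal.comp_continuousOn hcu)
    (by apply Continuous.intervalIntegrable; fun_prop)
  rw [hibp]
  have ht' : 0 < |t| := abs_pos.mpr ht
  have n1 : ‖∫ x in a..b, (G' x : ℂ) * V x‖ ≤ |G b - G a| / |t| := by
    rw [← habs, ← intervalIntegral.integral_div]
    apply intervalIntegral.norm_integral_le_of_norm_le hab
    · filter_upwards with x hx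
      rw [norm_mul, hVn, Complex.norm_real, Real.norm_eq_abs]
      apply le_of_eq; ring
    · exact (hcu.abs.div_const _).intervalIntegrable
  have n2 : ‖(G b : ℂ) * V b‖ = G b / |t| := by
    rw [norm_mul, hVn, Complex.norm_real, Real.norm_eq_abs, abs_of_nonneg (h0 b hb)]; ring
  have n3 : ‖(G a : ℂ) * V a‖ = G a / |t| := by
    rw [norm_mul, hVn, Complex.norm_real, Real.norm_eq_abs, abs_of_nonneg (h0 a ha)]; ring
  calc _ ≤ (G b / |t| + G a / |t| + |G b - G a| / |t|) * |t| := by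
        gcongr
        refine (norm_sub_le _ _).trans (add_le_add ((norm_sub_le _ _).trans ?_) n1)
        rw [n2, n3]
    _ = G b + G a + |G b - G a| := by field_simp
    _ ≤ 2 * W := by
        have := hW a ha; have := hW b hb
        rcases abs_cases (G b - G a) with ⟨h, _⟩ | ⟨h, _⟩ <;> rw [h] <;> linarith

lemma exp_abs_moment (j : ℕ) (hj : j ≤ 3) (y : ℝ) :
    |y| ^ j * Real.exp (-|y|) ≤ 1442 * (1 + y ^ 2)⁻¹ := by
  have hy := abs_nonneg y
  rw [← sq_abs y]
  generalize |y| = z at hy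
  rw [← div_eq_mul_inv, le_div_iff₀ (by positivity), Real.exp_neg]
  have h1 : z ^ 6 / 720 ≤ Real.exp z := by
    have := Real.pow_div_factorial_le_exp z hy 6
    simpa [Nat.factorial] using this
  have h2 : 1 ≤ Real.exp z := Real.one_le_exp hy
  have hc : ∀ j : ℕ, j ≤ 6 → z ^ j ≤ 1 + z ^ 6 := by
    intro j hj
    rcases le_total z 1 with h | h
    · have := pow_le_one₀ (n := j) hy h
      have : 0 ≤ z ^ 6 := by positivity
      linarith
    · have := pow_le_pow_right₀ h hj
      linarith
  have a1 := hc j (by omega)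
  have a2 := hc (j + 2) (by omega)
  have e : z ^ j * (Real.exp z)⁻¹ * (1 + z ^ 2) = (z ^ j + z ^ (j + 2)) / Real.exp z := by
    field_simp; ring
  rw [e, div_le_iff₀ (Real.exp_pos _)]
  linarith

lemma scaled_cauchy (s η : ℝ) (hη : 0 < η) :
    Integrable (fun x : ℝ => (1 + ((x - s) / η) ^ 2)⁻¹) ∧
    ∫ x : ℝ, (1 + ((x - s) / η) ^ 2)⁻¹ = η * Real.pi := by
  constructor
  · exact (integrable_inv_one_add_sq.comp_div hη.ne').comp_sub_right s
  · rw [integral_sub_right_eq_self (fun x : ℝ => (1 + (x / η) ^ 2)⁻¹) s,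
      Measure.integral_comp_div (fun x : ℝ => (1 + x ^ 2)⁻¹) η, integral_univ_inv_one_add_sq,
      abs_of_pos hη, smul_eq_mul]

def Kd : ℝ := 1442 * Real.pi
lemma Kd_pos : 2 < Kd := by unfold Kd; linarith [Real.pi_gt_three]


lemma wt_eq {β l s η : ℝ} (hs : 0 < s) (hη : 0 < η) (hl : l = s / η ^ 2) (hb : β = s ^ 3 / η ^ 2)
    {x : ℝ} (hx : 0 < x) :
    wt β l x = Real.exp (-(2 * s ^ 2 / η ^ 2)) * Real.exp (-(s / η ^ 2 * (x - s) ^ 2 / x)) := by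
  unfold wt
  rw [← Real.exp_add]
  congr 1
  subst hl hb
  field_simp
  ring

lemma wt_upper {β l s η : ℝ} (hs : 0 < s) (hη : 0 < η) (hl : l = s / η ^ 2) (hb : β = s ^ 3 / η ^ 2)
    (hsη : η ≤ s / 2) {x : ℝ} (hx : 0 < x) :
    wt β l x ≤ Real.exp (-(2 * s ^ 2 / η ^ 2)) * (Real.exp 1 * Real.exp (-|(x - s) / η|)) := by
  rw [wt_eq hs hη hl hb hx, ← Real.exp_add 1]
  apply mul_le_mul_of_nonneg_left _ (Real.exp_pos _).le
  apply Real.exp_le_exp.mpr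
  set y := |(x - s) / η| with hy
  have hy0 : 0 ≤ y := abs_nonneg _
  have hys : (x - s) ^ 2 = η ^ 2 * y ^ 2 := by rw [hy, sq_abs]; field_simp
  have hxy : x ≤ s * (1 + y) := by
    have h1 : (x - s) / η ≤ y := le_abs_self _
    rw [div_le_iff₀ hη] at h1
    nlinarith
  have e : s / η ^ 2 * (x - s) ^ 2 / x = s * y ^ 2 / x := by rw [hys]; field_simp
  rw [e]
  have : y - 1 ≤ s * y ^ 2 / x := by
    rw [le_div_iff₀ hx]
    rcases le_total y 1 with h | h
    · nlinarith [mul_nonneg (sub_nonneg.mpr h) hx.le, mul_nonneg hs.le (sq_nonneg y)]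
    · nlinarith [mul_le_mul_of_nonneg_left hxy (sub_nonneg.mpr h)]
  linarith

lemma wt_upper0 {β l s η : ℝ} (hs : 0 < s) (hη : 0 < η) (hl : l = s / η ^ 2) (hb : β = s ^ 3 / η ^ 2)
    {x : ℝ} (hx : 0 < x) :
    wt β l x ≤ Real.exp (-(2 * s ^ 2 / η ^ 2)) := by
  rw [wt_eq hs hη hl hb hx]
  have : Real.exp (-(s / η ^ 2 * (x - s) ^ 2 / x)) ≤ 1 := Real.exp_le_one_iff.mpr (by
    have : 0 ≤ s / η ^ 2 * (x - s) ^ 2 / x := by positivity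
    linarith)
  exact mul_le_of_le_one_right (Real.exp_pos _).le this

lemma wt_lower {β l s η : ℝ} (hs : 0 < s) (hη : 0 < η) (hl : l = s / η ^ 2) (hb : β = s ^ 3 / η ^ 2)
    (hsη : η ≤ s / 2) {x : ℝ} (hx : |x - s| ≤ η) :
    Real.exp (-(2 * s ^ 2 / η ^ 2)) * Real.exp (-2) ≤ wt β l x := by
  have h := abs_le.mp hx
  have hx0 : 0 < x := by linarith
  rw [wt_eq hs hη hl hb hx0]
  gcongr
  rw [div_le_iff₀ hx0]
  have : (x - s) ^ 2 ≤ η ^ 2 := by rw [← sq_abs]; gcongr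
  calc s / η ^ 2 * (x - s) ^ 2 ≤ s / η ^ 2 * η ^ 2 := by gcongr
    _ = s := by field_simp
    _ ≤ 2 * x := by linarith

lemma beta_pos {β l s η : ℝ} (hs : 0 < s) (hη : 0 < η) (hl : l = s / η ^ 2) (hb : β = s ^ 3 / η ^ 2) : 0 < β := by rw [hb]; positivity

lemma cpart_lower {β l s η : ℝ} (hs : 0 < s) (hη : 0 < η) (hl : l = s / η ^ 2) (hb : β = s ^ 3 / η ^ 2)
    (hsη : η ≤ s / 2) (hs1 : s + η < 1) :
    2 * η * (Real.exp (-(2 * s ^ 2 / η ^ 2)) * Real.exp (-2)) ≤ cpart β l := by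
  have hβ := beta_pos hs hη hl hb
  set A := Real.exp (-(2 * s ^ 2 / η ^ 2)) * Real.exp (-2) with hA
  have e1 : ∫ x in (s - η)..(s + η), A = 2 * η * A := by
    rw [intervalIntegral.integral_const, smul_eq_mul]; ring
  rw [← e1]
  have hsub : Set.Ioc (s - η) (s + η) ⊆ Set.Ioc 0 1 := by
    intro x hx; exact ⟨by linarith [hx.1], by linarith [hx.2]⟩
  have hInt : IntegrableOn (wt β l) (Set.Ioc 0 1) := by
    have := wt_iint β l hβ
    rwa [intervalIntegrable_iff_integrableOn_Ioc_of_le zero_le_one] at this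
  change _ ≤ ∫ x in (0:ℝ)..1, wt β l x
  rw [intervalIntegral.integral_of_le (by linarith), intervalIntegral.integral_of_le zero_le_one]
  refine le_trans ?_ (setIntegral_mono_set hInt ?_ hsub.eventuallyLE)
  · apply setIntegral_mono_on (integrableOn_const (by simp)) (hInt.mono_set hsub) measurableSet_Ioc
    intro x hx
    exact wt_lower hs hη hl hb hsη (by rw [abs_le]; constructor <;> linarith [hx.1, hx.2])
  · filter_upwards with x using (wt_pos _ _ _).le

lemma cpart_upper {β l s η : ℝ} (hs : 0 < s) (hη : 0 < η) (hl : l = s / η ^ 2) (hb : β = s ^ 3 / η ^ 2)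
    (hsη : η ≤ s / 2) :
    cpart β l ≤ Real.exp (-(2 * s ^ 2 / η ^ 2)) * Real.exp 1 * Kd * η := by
  have hβ := beta_pos hs hη hl hb
  set A := Real.exp (-(2 * s ^ 2 / η ^ 2)) with hA
  have hcl : Integrable (fun x : ℝ => A * Real.exp 1 * 1442 * (1 + ((x - s) / η) ^ 2)⁻¹) :=
    (scaled_cauchy s η hη).1.const_mul _
  change ∫ x in (0:ℝ)..1, wt β l x ≤ _
  rw [intervalIntegral.integral_of_le zero_le_one, integral_Ioc_eq_integral_Ioo]
  calc _ ≤ ∫ x in Set.Ioo (0:ℝ) 1, A * Real.exp 1 * 1442 * (1 + ((x - s) / η) ^ 2)⁻¹ := by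
        apply setIntegral_mono_on (wt_intOn β l hβ) hcl.integrableOn measurableSet_Ioo
        intro x hx
        refine (wt_upper hs hη hl hb hsη hx.1).trans ?_
        have h := exp_abs_moment 0 (by norm_num) ((x - s) / η)
        rw [pow_zero, one_mul] at h
        rw [← mul_assoc, mul_assoc (A * Real.exp 1)]
        gcongr
    _ ≤ ∫ x, A * Real.exp 1 * 1442 * (1 + ((x - s) / η) ^ 2)⁻¹ := by
        apply setIntegral_le_integral hcl
        filter_upwards with x
        positivity
    _ = _ := by
        rw [integral_const_mul, (scaled_cauchy s η hη).2, Kd]; ring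

lemma part_upper {β l s η : ℝ} (hs : 0 < s) (hη : 0 < η) (hl : l = s / η ^ 2) (hb : β = s ^ 3 / η ^ 2)
    (hsη : η ≤ s / 2) (hs1 : s + η < 1) (x : ℝ) :
    partDensity β l x ≤ Real.exp 3 / η * Real.exp (-|(x - s) / η|) := by
  have hβ := beta_pos hs hη hl hb
  have hc := cpart_pos β l hβ
  rw [partDensity_eq, Set.indicator_apply]
  split_ifs with hx
  · rw [div_le_iff₀ hc]
    refine (wt_upper hs hη hl hb hsη hx.1).trans ?_
    have h1 := cpart_lower hs hη hl hb hsη hs1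
    set A := Real.exp (-(2 * s ^ 2 / η ^ 2)) with hA
    have hA0 : 0 < A := Real.exp_pos _
    have e3 : Real.exp 3 * Real.exp (-2) = Real.exp 1 := by rw [← Real.exp_add]; norm_num
    calc A * (Real.exp 1 * Real.exp (-|(x - s) / η|))
        ≤ 2 * (A * (Real.exp 1 * Real.exp (-|(x - s) / η|))) := by
          have : 0 < A * (Real.exp 1 * Real.exp (-|(x - s) / η|)) := by positivity
          linarith
      _ = Real.exp 3 / η * Real.exp (-|(x - s) / η|) * (2 * η * (A * Real.exp (-2))) := by
          rw [← e3]; field_simp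
      _ ≤ _ := by gcongr
  · positivity

lemma part_lower {β l s η : ℝ} (hs : 0 < s) (hη : 0 < η) (hl : l = s / η ^ 2) (hb : β = s ^ 3 / η ^ 2)
    (hsη : η ≤ s / 2) (hs1 : s + η < 1) (x : ℝ) (hx : |x - s| ≤ η) :
    Real.exp (-3) / Kd / η ≤ partDensity β l x := by
  have hβ := beta_pos hs hη hl hb
  have hc := cpart_pos β l hβ
  have h := abs_le.mp hx
  have hxm : x ∈ Set.Ioo (0:ℝ) 1 := ⟨by linarith, by linarith⟩
  rw [partDensity_eq, Set.indicator_of_mem hxm, le_div_iff₀ hc]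
  refine le_trans ?_ (wt_lower hs hη hl hb hsη hx)
  have hK : 0 < Kd := by linarith [Kd_pos]
  calc _ ≤ Real.exp (-3) / Kd / η * (Real.exp (-(2 * s ^ 2 / η ^ 2)) * Real.exp 1 * Kd * η) := by
        gcongr
        exact cpart_upper hs hη hl hb hsη
    _ = Real.exp (-(2 * s ^ 2 / η ^ 2)) * (Real.exp (-3) * Real.exp 1) := by field_simp
    _ = _ := by rw [← Real.exp_add]; norm_num

lemma part_mom {β l s η : ℝ} (hs : 0 < s) (hη : 0 < η) (hl : l = s / η ^ 2) (hb : β = s ^ 3 / η ^ 2)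
    (hsη : η ≤ s / 2) (hs1 : s + η < 1) (j : ℕ) (hj : j ≤ 3) :
    Integrable (fun x => |x - s| ^ j * partDensity β l x) ∧
    ∫ x, |x - s| ^ j * partDensity β l x ≤ Real.exp 3 * Kd * η ^ j := by
  have hβ := beta_pos hs hη hl hb
  have hcl : Integrable (fun x : ℝ => Real.exp 3 / η * η ^ j * 1442 * (1 + ((x - s) / η) ^ 2)⁻¹) :=
    (scaled_cauchy s η hη).1.const_mul _
  have hbd : ∀ x, |x - s| ^ j * partDensity β l x
      ≤ Real.exp 3 / η * η ^ j * 1442 * (1 + ((x - s) / η) ^ 2)⁻¹ := by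
    intro x
    have h1 := part_upper hs hη hl hb hsη hs1 x
    have h2 := exp_abs_moment j hj ((x - s) / η)
    have h3 : |x - s| ^ j = η ^ j * |(x - s) / η| ^ j := by
      rw [abs_div, abs_of_pos hη, div_pow]; field_simp
    calc _ ≤ |x - s| ^ j * (Real.exp 3 / η * Real.exp (-|(x - s) / η|)) := by gcongr
      _ = Real.exp 3 / η * η ^ j * (|(x - s) / η| ^ j * Real.exp (-|(x - s) / η|)) := by
          rw [h3]; ring
      _ ≤ Real.exp 3 / η * η ^ j * (1442 * (1 + ((x - s) / η) ^ 2)⁻¹) := by gcongr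
      _ = _ := by ring
  have hI : Integrable (fun x => |x - s| ^ j * partDensity β l x) := by
    refine hcl.mono' ?_ ?_
    · have := (partDensity_nice β hβ l).meas
      apply Measurable.aestronglyMeasurable
      fun_prop
    · filter_upwards with x
      rw [Real.norm_eq_abs, abs_of_nonneg (mul_nonneg (by positivity) (partDensity_nonneg β l hβ x))]
      exact hbd x
  refine ⟨hI, (integral_mono hI hcl hbd).trans ?_⟩
  rw [integral_const_mul, (scaled_cauchy s η hη).2, Kd]
  apply le_of_eq; field_simp

lemma part_dec {β l s η : ℝ} (hs : 0 < s) (hη : 0 < η) (hl : l = s / η ^ 2) (hb : β = s ^ 3 / η ^ 2)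
    (hsη : η ≤ s / 2) (hs1 : s + η < 1) (t : ℝ) :
    ‖cfun (partDensity β l) t‖ * |t| ≤ Real.exp 3 * Kd / η := by
  have hβ := beta_pos hs hη hl hb
  have hc := cpart_pos β l hβ
  set A := Real.exp (-(2 * s ^ 2 / η ^ 2)) with hA
  have hA0 : 0 < A := Real.exp_pos _
  set J : ℝ → ℂ := fun x => (wt β l x : ℂ) * Complex.exp (Complex.I * t * x) with hJ
  have hJn : ∀ x, ‖J x‖ = wt β l x := by
    intro x
    simp only [hJ]
    rw [norm_mul, Complex.norm_exp, Complex.norm_real, Real.norm_eq_abs, abs_of_pos (wt_pos _ _ _)]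
    simp
  have e1 : cfun (partDensity β l) t = (∫ x in (0:ℝ)..1, J x) / (cpart β l : ℂ) := by
    unfold cfun
    rw [intervalIntegral.integral_of_le zero_le_one, integral_Ioc_eq_integral_Ioo,
      ← integral_indicator measurableSet_Ioo, ← integral_div]
    congr 1; ext x
    rw [partDensity_eq]
    simp only [Set.indicator_apply, hJ]
    split_ifs
    · push_cast; ring
    · simp
  have hJi : IntervalIntegrable J volume 0 1 := by
    have h1 := wt_iint β l hβ
    refine h1.mono_fun' ?_ ?_
    · apply Measurable.aestronglyMeasurable
      have := wt_meas β l
      simp only [hJ]; fun_prop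
    · filter_upwards with x using (hJn x).le
  have hd : ∀ x : ℝ, x ≠ 0 → HasDerivAt (wt β l) (wt β l x * (-l + β / x ^ 2)) x := by
    intro x hx
    unfold wt
    have h1 : HasDerivAt (fun x => -(l * x) - β / x) (-l + β / x ^ 2) x := by
      have h2 : HasDerivAt (fun x => -(l * x)) (-(l * 1)) x := ((hasDerivAt_id x).const_mul l).neg
      have h3 : HasDerivAt (fun x => β / x) ((0 * x - β * 1) / x ^ 2) x :=
        (hasDerivAt_const x β).div (hasDerivAt_id x) hx
      refine (h2.sub h3).congr_deriv ?_
      ring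
    exact h1.exp
  have hcont : ∀ a b : ℝ, 0 < a → ContinuousOn (fun x => wt β l x * (-l + β / x ^ 2)) (Set.Icc a b) := by
    intro a b ha x hx
    have hx0 : x ≠ 0 := by linarith [hx.1]
    have hx2 : x ^ 2 ≠ 0 := pow_ne_zero 2 hx0
    apply ContinuousAt.continuousWithinAt
    exact (wt_contAt β l hx0).mul (by fun_prop (disch := assumption))
  have hsign : ∀ x : ℝ, 0 < x → -l + β / x ^ 2 = s / η ^ 2 * ((s - x) * (s + x)) / x ^ 2 := by
    intro x hx
    rw [hl, hb]; field_simp; ring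
  have main : ∀ ε : ℝ, 0 < ε → ε < s → ‖∫ x in (0:ℝ)..1, J x‖ * |t| ≤ 4 * A + ε * (A * |t|) := by
    intro ε h0 h1
    have b1 := ibp_mono (wt β l) (fun x => wt β l x * (-l + β / x ^ 2)) ε s A t h1.le
      (fun x hx => hd x (by linarith [hx.1])) (hcont _ _ h0) (Or.inl (by
        intro x hx
        have hx0 : 0 < x := by linarith [hx.1]
        rw [hsign x hx0]
        have := wt_pos β l x
        have h2 : 0 ≤ s - x := by linarith [hx.2]
        positivity)) (fun x _ => (wt_pos _ _ _).le)
      (fun x hx => wt_upper0 hs hη hl hb (by linarith [hx.1]))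
    have b2 := ibp_mono (wt β l) (fun x => wt β l x * (-l + β / x ^ 2)) s 1 A t (by linarith)
      (fun x hx => hd x (by linarith [hx.1])) (hcont _ _ hs) (Or.inr (by
        intro x hx
        have hx0 : 0 < x := by linarith [hx.1]
        have h3 : -l + β / x ^ 2 = -(s / η ^ 2 * ((x - s) * (s + x)) / x ^ 2) := by
          rw [hsign x hx0]; ring
        rw [h3]
        have := wt_pos β l x
        have h2 : 0 ≤ x - s := by linarith [hx.1]
        have : 0 ≤ wt β l x * (s / η ^ 2 * ((x - s) * (s + x)) / x ^ 2) := by positivity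
        linarith)) (fun x _ => (wt_pos _ _ _).le)
      (fun x hx => wt_upper0 hs hη hl hb (by linarith [hx.1]))
    have b0 : ‖∫ x in (0:ℝ)..ε, J x‖ ≤ A * |ε - 0| := by
      apply intervalIntegral.norm_integral_le_of_norm_le_const
      intro x hx
      rw [Set.uIoc_of_le h0.le] at hx
      rw [hJn]
      exact wt_upper0 hs hη hl hb hx.1
    rw [sub_zero, abs_of_pos h0] at b0
    have i1 : IntervalIntegrable J volume 0 ε := hJi.mono_set (by
      rw [Set.uIcc_of_le h0.le, Set.uIcc_of_le zero_le_one]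
      exact Set.Icc_subset_Icc le_rfl (by linarith))
    have i2 : IntervalIntegrable J volume ε s := hJi.mono_set (by
      rw [Set.uIcc_of_le h1.le, Set.uIcc_of_le zero_le_one]
      exact Set.Icc_subset_Icc h0.le (by linarith))
    have i3 : IntervalIntegrable J volume s 1 := hJi.mono_set (by
      rw [Set.uIcc_of_le (by linarith), Set.uIcc_of_le zero_le_one]
      exact Set.Icc_subset_Icc hs.le le_rfl)
    rw [← intervalIntegral.integral_add_adjacent_intervals (i1.trans i2) i3,
      ← intervalIntegral.integral_add_adjacent_intervals i1 i2]
    calc _ ≤ (‖∫ x in (0:ℝ)..ε, J x‖ + ‖∫ x in ε..s, J x‖ + ‖∫ x in s..1, J x‖) * |t| := by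
          gcongr
          exact norm_add₃_le
      _ ≤ (A * ε) * |t| + 2 * A + 2 * A := by
          rw [add_mul, add_mul]
          gcongr
      _ = _ := by ring
  have hlim : ‖∫ x in (0:ℝ)..1, J x‖ * |t| ≤ 4 * A := by
    have ht : Tendsto (fun ε : ℝ => 4 * A + ε * (A * |t|)) (nhdsWithin 0 (Set.Ioi 0)) (nhds (4 * A)) := by
      have : Continuous (fun ε : ℝ => 4 * A + ε * (A * |t|)) := by fun_prop
      have h2 := this.tendsto 0
      simp only [zero_mul, add_zero] at h2
      exact h2.mono_left nhdsWithin_le_nhds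
    refine ge_of_tendsto ht ?_
    filter_upwards [Ioo_mem_nhdsGT hs] with ε hε using main ε hε.1 hε.2
  rw [e1, norm_div, Complex.norm_real, Real.norm_eq_abs, abs_of_pos hc, div_mul_eq_mul_div,
    div_le_iff₀ hc]
  refine hlim.trans ?_
  have h1 := cpart_lower hs hη hl hb hsη hs1
  have e3 : Real.exp 3 * Real.exp (-2) = Real.exp 1 := by rw [← Real.exp_add]; norm_num
  have hK := Kd_pos
  calc 4 * A ≤ 2 * A * Kd * Real.exp 1 := by
        have : 1 ≤ Real.exp 1 := Real.one_le_exp zero_le_one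
        nlinarith [mul_pos hA0 (by linarith : 0 < Kd - 2), mul_nonneg (mul_pos hA0 (by linarith : 0 < Kd)).le (sub_nonneg.mpr this)]
    _ = Real.exp 3 * Kd / η * (2 * η * (A * Real.exp (-2))) := by
        rw [← e3]; field_simp
    _ ≤ _ := by
        have : 0 < Kd := by linarith
        gcongr

lemma part_core {β l s η : ℝ} (hs : 0 < s) (hη : 0 < η) (hl : l = s / η ^ 2) (hb : β = s ^ 3 / η ^ 2)
    (hsη : η ≤ s / 2) (hs1 : s + η < 1) :
    Core (partDensity β l) s η (Real.exp (-3) / Kd) (Real.exp 3 * Kd) := by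
  have hβ := beta_pos hs hη hl hb
  exact ⟨partDensity_nice β hβ l, partDensity_nonneg β l hβ, int_part_one β l hβ,
    part_lower hs hη hl hb hsη hs1, fun j hj => (part_mom hs hη hl hb hsη hs1 j hj).1,
    fun j hj => (part_mom hs hη hl hb hsη hs1 j hj).2, part_dec hs hη hl hb hsη hs1⟩


def sP (β l : ℝ) : ℝ := Real.sqrt (β / l)
def eP (β l : ℝ) : ℝ := Real.sqrt (sP β l / l)
def c0P : ℝ := Real.exp (-3) / Kd
def C0P : ℝ := Real.exp 3 * Kd

lemma c0P_pos : 0 < c0P := by unfold c0P; have := Kd_pos; positivity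
lemma C0P_pos : 0 < C0P := by unfold C0P; have := Kd_pos; positivity

lemma sP_pos {β l : ℝ} (hβ : 0 < β) (hl : 0 < l) : 0 < sP β l := Real.sqrt_pos.mpr (by positivity)
lemma sP_sq {β l : ℝ} (hβ : 0 < β) (hl : 0 < l) : sP β l ^ 2 = β / l := Real.sq_sqrt (by positivity)
lemma eP_pos {β l : ℝ} (hβ : 0 < β) (hl : 0 < l) : 0 < eP β l :=
  Real.sqrt_pos.mpr (div_pos (sP_pos hβ hl) hl)
lemma eP_sq {β l : ℝ} (hβ : 0 < β) (hl : 0 < l) : eP β l ^ 2 = sP β l / l :=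
  Real.sq_sqrt (div_pos (sP_pos hβ hl) hl).le

lemma part_core' {β : ℝ} (hβ : 0 < β) : ∃ L > 0, ∀ l ≥ L,
    Core (partDensity β l) (sP β l) (eP β l) c0P C0P := by
  refine ⟨16 / β + 4 * β, by positivity, ?_⟩
  intro l hl
  have hl1 : 16 / β ≤ l := by linarith
  have hl2 : 4 * β ≤ l := by have : 0 < 16 / β := by positivity
                             linarith
  have hl0 : 0 < l := by linarith
  have hs := sP_pos hβ hl0
  have he := eP_pos hβ hl0
  have hs2 := sP_sq hβ hl0
  have he2 := eP_sq hβ hl0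
  have hsle : sP β l ≤ 1 / 2 := by
    have : sP β l ^ 2 ≤ (1 / 2) ^ 2 := by
      rw [hs2, div_le_iff₀ hl0]; linarith
    exact le_of_sq_le_sq this (by norm_num)
  have hes : eP β l ≤ sP β l / 2 := by
    have h4 : 4 ≤ l * sP β l := by
      have : (4:ℝ) ^ 2 ≤ (l * sP β l) ^ 2 := by
        rw [mul_pow, hs2]
        rw [div_le_iff₀ hβ] at hl1
        have : l ^ 2 * (β / l) = l * β := by field_simp
        rw [this]; linarith
      exact le_of_sq_le_sq this (by positivity)
    have : eP β l ^ 2 ≤ (sP β l / 2) ^ 2 := by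
      rw [he2, div_le_iff₀ hl0]
      nlinarith
    exact le_of_sq_le_sq this (by positivity)
  apply part_core hs he _ _ hes (by linarith)
  · rw [he2]; field_simp
  · rw [he2, pow_succ, hs2]; field_simp

lemma mpart_asymp {β : ℝ} (hβ : 0 < β) (ε : ℝ) (hε : 0 < ε) : ∃ L > 0, ∀ l ≥ L,
    |Real.sqrt l * mpart β l - Real.sqrt β| ≤ ε := by
  obtain ⟨L, hL, H⟩ := part_core' hβ
  have hC := C0P_pos
  set δ := (ε / C0P) ^ 2 with hδ
  have hδ0 : 0 < δ := by positivity
  refine ⟨max L (β / δ ^ 2), lt_max_of_lt_left hL, ?_⟩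
  intro l hl
  have hl1 : L ≤ l := (le_max_left _ _).trans hl
  have hl2 : β / δ ^ 2 ≤ l := (le_max_right _ _).trans hl
  have hl0 : 0 < l := by linarith
  have h := core_mean (H l hl1)
  rw [← mpart_eq] at h
  have e1 : Real.sqrt β = Real.sqrt l * sP β l := by
    unfold sP
    rw [← Real.sqrt_mul hl0.le]; congr 1; field_simp
  have e2 : Real.sqrt l * eP β l ≤ ε / C0P := by
    have : (Real.sqrt l * eP β l) ^ 2 ≤ (ε / C0P) ^ 2 := by
      rw [mul_pow, Real.sq_sqrt hl0.le, eP_sq hβ hl0, ← hδ]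
      have e3 : l * (sP β l / l) = sP β l := by field_simp
      rw [e3]
      have : sP β l ^ 2 ≤ δ ^ 2 := by
        rw [sP_sq hβ hl0]
        rw [div_le_iff₀ (by positivity)] at hl2 ⊢
        linarith
      exact le_of_sq_le_sq this hδ0.le
    exact le_of_sq_le_sq this (by positivity)
  rw [e1, ← mul_sub, abs_mul, abs_of_nonneg (Real.sqrt_nonneg _)]
  calc _ ≤ Real.sqrt l * (C0P * eP β l) := by gcongr
    _ = C0P * (Real.sqrt l * eP β l) := by ring
    _ ≤ C0P * (ε / C0P) := by gcongr
    _ = ε := by field_simp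

lemma xwt_iint (β l : ℝ) (hβ : 0 < β) (g : ℝ → ℝ) (hg : Continuous g) :
    IntervalIntegrable (fun x => g x * wt β l x) volume 0 1 :=
  (wt_iint β l hβ).continuousOn_mul hg.continuousOn

lemma mpart_anti {β : ℝ} (hβ : 0 < β) {l₁ l₂ : ℝ} (h : l₁ ≤ l₂) : mpart β l₂ ≤ mpart β l₁ := by
  have c1 := cpart_pos β l₁ hβ
  have c2 := cpart_pos β l₂ hβ
  set m := mpart β l₁ with hm
  have hm1 : (∫ x in (0:ℝ)..1, x * wt β l₁ x) = m * cpart β l₁ := by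
    rw [hm]; unfold mpart wt; rw [div_mul_cancel₀ _ c1.ne']
  have hz : ∫ x in (0:ℝ)..1, (x - m) * wt β l₁ x = 0 := by
    have : ∀ x, (x - m) * wt β l₁ x = x * wt β l₁ x - m * wt β l₁ x := fun x => by ring
    simp_rw [this]
    rw [intervalIntegral.integral_sub (xwt_iint β l₁ hβ (fun x => x) continuous_id)
      ((wt_iint β l₁ hβ).const_mul m), hm1, intervalIntegral.integral_const_mul]
    unfold cpart wt; ring
  have hle : ∫ x in (0:ℝ)..1, (x - m) * wt β l₂ x
      ≤ ∫ x in (0:ℝ)..1, Real.exp (-((l₂ - l₁) * m)) * ((x - m) * wt β l₁ x) := by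
    apply intervalIntegral.integral_mono_on zero_le_one (xwt_iint β l₂ hβ _ (by fun_prop))
      ((xwt_iint β l₁ hβ (fun x => x - m) (by fun_prop)).const_mul _)
    intro x _
    have e : wt β l₂ x = Real.exp (-((l₂ - l₁) * x)) * wt β l₁ x := by
      unfold wt; rw [← Real.exp_add]; congr 1; ring
    rw [e]
    have hw := wt_pos β l₁ x
    have key : (x - m) * Real.exp (-((l₂ - l₁) * x)) ≤ (x - m) * Real.exp (-((l₂ - l₁) * m)) := by
      rcases le_total x m with hx | hx
      · apply mul_le_mul_of_nonpos_left _ (by linarith)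
        apply Real.exp_le_exp.mpr
        nlinarith
      · apply mul_le_mul_of_nonneg_left _ (by linarith)
        apply Real.exp_le_exp.mpr
        nlinarith
    have := mul_le_mul_of_nonneg_right key hw.le
    linarith
  rw [intervalIntegral.integral_const_mul, hz, mul_zero] at hle
  have : ∀ x, (x - m) * wt β l₂ x = x * wt β l₂ x - m * wt β l₂ x := fun x => by ring
  simp_rw [this] at hle
  rw [intervalIntegral.integral_sub (xwt_iint β l₂ hβ (fun x => x) continuous_id)
      ((wt_iint β l₂ hβ).const_mul m), intervalIntegral.integral_const_mul] at hle
  unfold mpart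
  rw [div_le_iff₀ c2]
  unfold wt at hle
  change _ - m * cpart β l₂ ≤ 0 at hle
  linarith

lemma sum_inv_sqrt (A B : ℝ) (hA : 0 < A) (hB : 0 < B) (n : ℕ) :
    2 / B * (Real.sqrt (A + (n + 1) * B) - Real.sqrt (A + B))
      ≤ ∑ k ∈ Finset.Icc 1 n, 1 / Real.sqrt (A + k * B) := by
  induction n with
  | zero => simp
  | succ n ih =>
    rw [Finset.sum_Icc_succ_top (by omega)]
    push_cast
    have p1 : 0 < A + (n + 1) * B := by positivity
    set p := Real.sqrt (A + (n + 1) * B) with hp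
    set q := Real.sqrt (A + (n + 1 + 1) * B) with hq
    have hp0 : 0 < p := Real.sqrt_pos.mpr p1
    have hp2 : p ^ 2 = A + (n + 1) * B := Real.sq_sqrt p1.le
    have hq2 : q ^ 2 = A + (n + 1 + 1) * B := Real.sq_sqrt (by positivity)
    have hpq : p ≤ q := Real.sqrt_le_sqrt (by linarith)
    have : 2 / B * (q - p) ≤ 1 / p := by
      rw [div_mul_eq_mul_div, div_le_div_iff₀ hB hp0]
      nlinarith
    have e : 2 / B * (q - Real.sqrt (A + B)) = 2 / B * (q - p) + 2 / B * (p - Real.sqrt (A + B)) := by ring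
    linarith

set_option maxHeartbeats 2000000 in
lemma lam_location {β F₀ : ℝ} (hβ : 0 < β) (hF₀0 : 0 ≤ F₀) (hF₀ : F₀ < 4 * β)
    (F : ℕ → ℝ) (hF0 : ∀ N, 0 ≤ F N)
    (hF : Tendsto (fun N : ℕ => F N / N) atTop (nhds F₀))
    (lam : ℕ → ℝ)
    (hlam : ∀ N : ℕ, 2 ≤ N →
      ∑ k ∈ Finset.Icc 1 N, mpart β (lam N + (k : ℝ) * F N) = 1) :
    ∃ a > 0, ∃ b > 0, ∃ N₀ : ℕ, ∀ N ≥ N₀, a * N ^ 2 ≤ lam N ∧ lam N + N * F N ≤ b * N ^ 2 := by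
  set F₁ := (F₀ + 4 * β) / 2 with hF₁
  have hF₁pos : 0 < F₁ := by rw [hF₁]; linarith
  have hF₁lt : F₁ < 4 * β := by rw [hF₁]; linarith
  have hev : ∀ᶠ N : ℕ in atTop, F N / N < F₁ := hF.eventually_lt_const (by rw [hF₁]; linarith)
  set p := Real.sqrt β with hp
  set q := Real.sqrt F₁ with hq
  have hp0 : 0 < p := Real.sqrt_pos.mpr hβ
  have hq0 : 0 < q := Real.sqrt_pos.mpr hF₁pos
  have hp2 : p ^ 2 = β := Real.sq_sqrt hβ.le
  have hq2 : q ^ 2 = F₁ := Real.sq_sqrt hF₁pos.le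
  have hqp : q < 2 * p := by
    apply lt_of_pow_lt_pow_left₀ 2 (by positivity)
    rw [mul_pow, hp2, hq2]; linarith
  set δ := q * (2 * p - q) / (4 * (p + q)) with hδ
  have hδ0 : 0 < δ := by
    have : 0 < 2 * p - q := by linarith
    positivity
  have hδe : δ * (4 * (p + q)) = q * (2 * p - q) := by rw [hδ]; field_simp
  have hδp : δ < p := by
    by_contra hcon; push Not at hcon
    nlinarith [mul_le_mul_of_nonneg_right hcon (by positivity : 0 ≤ 4 * (p + q))]
  have hδq : δ < q := by
    by_contra hcon; push Not at hcon
    nlinarith [mul_le_mul_of_nonneg_right hcon (by positivity : 0 ≤ 4 * (p + q))]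
  have hkey : F₁ < 2 * ((p - δ) * (q - δ)) := by
    rw [← hq2]; nlinarith
  set a := δ ^ 2 / 2 with ha
  have ha0 : 0 < a := by positivity
  obtain ⟨L1, hL1, H1⟩ := mpart_asymp hβ δ hδ0
  obtain ⟨L2, hL2, H2⟩ := mpart_asymp hβ p hp0
  have t1 : Tendsto (fun N : ℕ => (N:ℝ)) atTop atTop := tendsto_natCast_atTop_atTop
  have hev2 : ∀ᶠ N : ℕ in atTop, 2 * F₁ / δ ^ 2 + L1 / a + L2 / (16 * β) + 2 ≤ (N:ℝ) :=
    t1.eventually_ge_atTop _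
  obtain ⟨N₀, hN₀⟩ := eventually_atTop.mp (hev.and hev2)
  refine ⟨a, ha0, 16 * β + F₁, by positivity, N₀, ?_⟩
  intro N hN
  obtain ⟨hFN, hNl⟩ := hN₀ N hN
  have g1 : 0 < 2 * F₁ / δ ^ 2 := by positivity
  have g2 : 0 < L1 / a := by positivity
  have g3 : 0 < L2 / (16 * β) := by positivity
  have hN2 : (2:ℝ) ≤ N := by linarith
  have hN2' : 2 ≤ N := by exact_mod_cast hN2
  have hNpos : (0:ℝ) < N := by linarith
  have hNsq : (N:ℝ) ≤ N ^ 2 := by nlinarith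
  rw [div_lt_iff₀ hNpos] at hFN
  have hsum := hlam N hN2'
  constructor
  · by_contra hcon
    push Not at hcon
    have hA : 0 < a * (N:ℝ) ^ 2 := by positivity
    have hB : 0 < F₁ * (N:ℝ) := by positivity
    have hterm : ∀ k ∈ Finset.Icc 1 N, (p - δ) * (1 / Real.sqrt (a * (N:ℝ) ^ 2 + k * (F₁ * N)))
        ≤ mpart β (lam N + (k : ℝ) * F N) := by
      intro k hk
      have hu : lam N + (k:ℝ) * F N ≤ a * (N:ℝ) ^ 2 + k * (F₁ * N) := by
        have : (k:ℝ) * F N ≤ k * (F₁ * N) := by gcongr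
        linarith
      refine le_trans ?_ (mpart_anti hβ hu)
      have hbig : L1 ≤ a * (N:ℝ) ^ 2 + k * (F₁ * N) := by
        have h1 : L1 / a ≤ (N:ℝ) ^ 2 := by linarith
        rw [div_le_iff₀ ha0] at h1
        have : 0 ≤ (k:ℝ) * (F₁ * N) := by positivity
        linarith
      have h3 := (abs_le.mp (H1 _ hbig)).1
      have hpos : 0 < Real.sqrt (a * (N:ℝ) ^ 2 + k * (F₁ * N)) :=
        Real.sqrt_pos.mpr (by linarith)
      rw [mul_one_div, div_le_iff₀ hpos]
      linarith
    have h4 := Finset.sum_le_sum hterm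
    rw [hsum, ← Finset.mul_sum] at h4
    have h5 := sum_inv_sqrt _ _ hA hB N
    have h6 : q * N ≤ Real.sqrt (a * (N:ℝ) ^ 2 + (N + 1) * (F₁ * N)) := by
      apply Real.le_sqrt_of_sq_le
      rw [mul_pow, hq2]
      nlinarith
    have h7 : Real.sqrt (a * (N:ℝ) ^ 2 + F₁ * N) ≤ δ * N := by
      rw [Real.sqrt_le_left (by positivity), mul_pow]
      have h8 : 2 * F₁ / δ ^ 2 ≤ N := by linarith
      rw [div_le_iff₀ (by positivity)] at h8
      have : F₁ * N ≤ δ ^ 2 / 2 * N ^ 2 := by nlinarith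
      rw [ha]; linarith
    have h9 : 2 / F₁ * (q - δ) ≤ 2 / (F₁ * N) * (Real.sqrt (a * (N:ℝ) ^ 2 + (N + 1) * (F₁ * N))
        - Real.sqrt (a * (N:ℝ) ^ 2 + F₁ * N)) := by
      calc 2 / F₁ * (q - δ) = 2 / (F₁ * N) * (q * N - δ * N) := by field_simp
        _ ≤ _ := by gcongr
    have h10 : (p - δ) * (2 / F₁ * (q - δ)) ≤ 1 :=
      (mul_le_mul_of_nonneg_left (h9.trans h5) (by linarith)).trans h4
    have h11 : (p - δ) * (2 / F₁ * (q - δ)) = 2 * ((p - δ) * (q - δ)) / F₁ := by ring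
    rw [h11, div_le_one hF₁pos] at h10
    linarith
  · have hlamle : lam N ≤ 16 * β * N ^ 2 := by
      by_contra hcon
      push Not at hcon
      have hbig : L2 ≤ 16 * β * (N:ℝ) ^ 2 := by
        have h1 : L2 / (16 * β) ≤ (N:ℝ) ^ 2 := by linarith
        rw [div_le_iff₀ (by positivity)] at h1
        linarith
      have h3 := (abs_le.mp (H2 _ hbig)).2
      have e : Real.sqrt (16 * β * (N:ℝ) ^ 2) = 4 * p * N := by
        rw [show 16 * β * (N:ℝ) ^ 2 = (4 * p * N) ^ 2 by rw [mul_pow, mul_pow, hp2]; ring]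
        exact Real.sqrt_sq (by positivity)
      rw [e] at h3
      have h4 : mpart β (16 * β * (N:ℝ) ^ 2) ≤ 1 / (2 * N) := by
        rw [le_div_iff₀ (by positivity)]
        by_contra h5
        push Not at h5
        nlinarith
      have hterm : ∀ k ∈ Finset.Icc 1 N, mpart β (lam N + (k : ℝ) * F N) ≤ 1 / (2 * N) := by
        intro k hk
        refine (mpart_anti hβ ?_).trans h4
        have : 0 ≤ (k:ℝ) * F N := mul_nonneg (Nat.cast_nonneg _) (hF0 N)
        linarith
      have h5 := Finset.sum_le_sum hterm
      rw [hsum] at h5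
      simp at h5
      have : (N:ℝ) * ((N:ℝ)⁻¹ * 2⁻¹) = 1 / 2 := by field_simp
      linarith
    have : (N:ℝ) * F N ≤ F₁ * N ^ 2 := by nlinarith
    linarith

lemma cfun_cont {f : ℝ → ℝ} (hf : Integrable f) : Continuous (cfun f) := by
  unfold cfun
  apply continuous_of_dominated (bound := fun x => ‖f x‖)
  · intro t
    exact (hf.ofReal.aestronglyMeasurable).mul (by fun_prop)
  · intro t
    filter_upwards with x
    rw [norm_mul, show Complex.I * (t:ℂ) * (x:ℂ) = ((t * x : ℝ):ℂ) * Complex.I by push_cast; ring,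
      Complex.norm_exp_ofReal_mul_I, mul_one, Complex.norm_real]
  · exact hf.norm
  · filter_upwards with x
    fun_prop

lemma range_map_prod (N : ℕ) (g : ℕ → ℝ) (H : ℝ → ℂ) :
    (((List.range N).map g).map H).prod = ∏ k ∈ Finset.range N, H (g k) := by
  rw [List.map_map]
  rfl

lemma sum_Icc_range (N : ℕ) (G : ℝ → ℝ) :
    ∑ k ∈ Finset.Icc 1 N, G (k:ℝ) = ∑ k ∈ Finset.range N, G ((k:ℝ) + 1) := by
  induction N with
  | zero => simp
  | succ n ih => rw [Finset.sum_Icc_succ_top (by omega), Finset.sum_range_succ, ih]; push_cast; rfl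

lemma gauss_eval (σ x : ℝ) (hσ : 0 < σ) :
    (σ:ℂ) * ((1 / (2 * Real.pi)) * ∫ t : ℝ, Complex.exp (-(Complex.I * t * (σ * x : ℝ))) *
      ((Real.exp (-(σ ^ 2 * t ^ 2 / 2)) : ℝ) : ℂ))
    = ((1 / Real.sqrt (2 * Real.pi) * Real.exp (-x ^ 2 / 2) : ℝ) : ℂ) := by
  have hb : 0 < (((σ ^ 2 / 2 : ℝ) : ℂ)).re := by rw [Complex.ofReal_re]; positivity
  have h := fourierIntegral_gaussian hb ((-(σ * x) : ℝ) : ℂ)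
  have e : ∀ t : ℝ, Complex.exp (-(Complex.I * t * (σ * x : ℝ))) *
      ((Real.exp (-(σ ^ 2 * t ^ 2 / 2)) : ℝ) : ℂ) =
      Complex.exp (Complex.I * ((-(σ * x) : ℝ) : ℂ) * t) * Complex.exp (-((σ ^ 2 / 2 : ℝ):ℂ) * t ^ 2) := by
    intro t
    rw [Complex.ofReal_exp]
    congr 2
    · push_cast; ring
    · push_cast; ring
  simp_rw [e]
  rw [h]
  have e1 : ((Real.pi:ℂ) / ((σ ^ 2 / 2 : ℝ):ℂ)) ^ (1 / 2 : ℂ) = ((Real.sqrt (2 * Real.pi) / σ : ℝ) : ℂ) := by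
    rw [← Complex.ofReal_div, show (1 / 2 : ℂ) = ((1 / 2 : ℝ):ℂ) by push_cast; rfl,
      ← Complex.ofReal_cpow (by positivity), ← Real.sqrt_eq_rpow]
    congr 1
    rw [show Real.pi / (σ ^ 2 / 2) = (2 * Real.pi) / σ ^ 2 by field_simp,
      Real.sqrt_div (by positivity), Real.sqrt_sq hσ.le]
  have e2 : Complex.exp (-(((-(σ * x) : ℝ) : ℂ)) ^ 2 / (4 * ((σ ^ 2 / 2 : ℝ):ℂ)))
      = ((Real.exp (-x ^ 2 / 2) : ℝ) : ℂ) := by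
    rw [Complex.ofReal_exp]
    congr 1
    have : (σ:ℂ) ≠ 0 := by exact_mod_cast hσ.ne'
    push_cast
    field_simp
    ring
  rw [e1, e2]
  have h3 : σ * (1 / (2 * Real.pi) * (Real.sqrt (2 * Real.pi) / σ * Real.exp (-x ^ 2 / 2)))
      = 1 / Real.sqrt (2 * Real.pi) * Real.exp (-x ^ 2 / 2) := by
    have hs : Real.sqrt (2 * Real.pi) ^ 2 = 2 * Real.pi := Real.sq_sqrt (by positivity)
    have hs0 : 0 < Real.sqrt (2 * Real.pi) := Real.sqrt_pos.mpr (by positivity)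
    rw [← hs, Real.sqrt_sq hs0.le]; field_simp
  rw [← h3]; push_cast; ring

lemma eP_anti {β l₁ l₂ : ℝ} (hβ : 0 < β) (h1 : 0 < l₁) (h : l₁ ≤ l₂) : eP β l₂ ≤ eP β l₁ := by
  have h2 : 0 < l₂ := by linarith
  unfold eP
  apply Real.sqrt_le_sqrt
  have : sP β l₂ ≤ sP β l₁ := by
    unfold sP
    apply Real.sqrt_le_sqrt
    gcongr
  have := sP_pos hβ h1
  gcongr

lemma eP_scale {β a n h : ℝ} (hβ : 0 < β) (ha : 0 < a) (hn : 0 < n) (hh : 0 < h)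
    (hhn : h ^ 2 * n ^ 3 = 1) : eP β (a * n ^ 2) = eP β a * h := by
  have hs : sP β (a * n ^ 2) = sP β a / n := by
    unfold sP
    rw [show β / (a * n ^ 2) = (β / a) / n ^ 2 by field_simp, Real.sqrt_div (by positivity),
      Real.sqrt_sq hn.le]
  have e1 : eP β (a * n ^ 2) ^ 2 = (eP β a * h) ^ 2 := by
    rw [mul_pow, eP_sq hβ (by positivity), eP_sq hβ ha, hs]
    have : h ^ 2 = 1 / n ^ 3 := by field_simp; linarith
    rw [this]; field_simp
  have p1 := eP_pos hβ (show 0 < a * n ^ 2 by positivity)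
  have p2 := eP_pos hβ ha
  exact (pow_left_inj₀ p1.le (by positivity) (by norm_num)).mp e1

lemma part_bounds {β a b : ℝ} (hβ : 0 < β) (ha : 0 < a) (hb : 0 < b) :
    ∃ c > 0, ∃ C > 0, ∃ N₁ : ℕ, ∀ N : ℕ, N₁ ≤ N → 2 ≤ N → ∀ h : ℝ, 0 < h → h ^ 2 * (N:ℝ) ^ 3 = 1 →
    ∀ l, a * (N:ℝ) ^ 2 ≤ l → l ≤ b * (N:ℝ) ^ 2 → ∀ τ : ℝ,
      c ≤ vpart β l / h ^ 2 ∧ vpart β l / h ^ 2 ≤ C ∧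
      ‖cfun (partDensity β l) τ * Complex.exp (-(Complex.I * τ * mpart β l))‖
        ≤ Real.exp (-(c * min 1 ((h * τ) ^ 2))) ∧
      ‖cfun (partDensity β l) τ * Complex.exp (-(Complex.I * τ * mpart β l))
        - (1 - ((vpart β l / h ^ 2 * (h * τ) ^ 2 / 2 : ℝ) : ℂ))‖ ≤ C * |h * τ| ^ 3 ∧
      ‖cfun (partDensity β l) τ * Complex.exp (-(Complex.I * τ * mpart β l))‖ * |h * τ| ≤ C := by
  obtain ⟨L, hL, H⟩ := part_core' hβ
  have hc0 := c0P_pos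
  have hC0 := C0P_pos
  set κ1 := eP β b with hκ1
  set κ2 := eP β a with hκ2
  have k1 : 0 < κ1 := eP_pos hβ hb
  have k2 : 0 < κ2 := eP_pos hβ ha
  have hmin : 0 < min 1 (κ1 ^ 2) := lt_min one_pos (by positivity)
  refine ⟨min (c0P / 2 * κ1 ^ 2) (c0P / 10 * min 1 (κ1 ^ 2)), lt_min (by positivity) (by positivity),
    C0P * κ2 ^ 2 + 16 * (C0P + C0P ^ 3) * κ2 ^ 3 + C0P / κ1, by positivity, ⌈L / a⌉₊, ?_⟩
  intro N hN hN2 h hh hhN l hl1 hl2 τ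
  have hN2' : (2:ℝ) ≤ N := by exact_mod_cast hN2
  have hNpos : (0:ℝ) < N := by linarith
  have hlL : L ≤ l := by
    have h1 : L / a ≤ N := (Nat.le_ceil _).trans (by exact_mod_cast hN)
    have h2 : L / a ≤ (N:ℝ) ^ 2 := by nlinarith
    rw [div_le_iff₀ ha] at h2
    linarith
  have hl0 : 0 < l := by linarith
  have core := H l hlL
  set η := eP β l with hη
  have η0 : 0 < η := eP_pos hβ hl0
  have η1 : κ1 * h ≤ η := by
    rw [hκ1, ← eP_scale hβ hb hNpos hh hhN]; exact eP_anti hβ hl0 hl2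
  have η2 : η ≤ κ2 * h := by
    rw [hκ2, ← eP_scale hβ ha hNpos hh hhN]; exact eP_anti hβ (by positivity) hl1
  have hE : ‖Complex.exp (-(Complex.I * τ * mpart β l))‖ = 1 := by
    rw [show -(Complex.I * (τ:ℂ) * (mpart β l:ℂ)) = ((-(τ * mpart β l) : ℝ):ℂ) * Complex.I by
      push_cast; ring, Complex.norm_exp_ofReal_mul_I]
  rw [norm_mul, hE, mul_one]
  obtain ⟨v1, v2⟩ := core_var core η0 hc0 _ _ (mpart_eq β l) (vpart_eq β l)
  have ct := core_taylor core η0 hC0 _ _ (mpart_eq β l) (vpart_eq β l) τ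
  have cc := core_cfun core η0 hc0 τ
  have cd := core.dec τ
  have h2 : 0 < h ^ 2 := by positivity
  have s1 : κ1 ^ 2 * h ^ 2 ≤ η ^ 2 := by rw [← mul_pow]; gcongr
  have s2 : η ^ 2 ≤ κ2 ^ 2 * h ^ 2 := by rw [← mul_pow]; gcongr
  have q1 : 0 < C0P * κ2 ^ 2 := by positivity
  have q2 : 0 < 16 * (C0P + C0P ^ 3) * κ2 ^ 3 := by positivity
  have q3 : 0 < C0P / κ1 := by positivity
  refine ⟨?_, ?_, ?_, ?_, ?_⟩
  · refine (min_le_left _ _).trans ?_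
    rw [le_div_iff₀ h2]
    refine le_trans ?_ v1
    calc c0P / 2 * κ1 ^ 2 * h ^ 2 = c0P / 2 * (κ1 ^ 2 * h ^ 2) := by ring
      _ ≤ _ := by gcongr
  · have : vpart β l / h ^ 2 ≤ C0P * κ2 ^ 2 := by
      rw [div_le_iff₀ h2]
      refine v2.trans ?_
      calc C0P * η ^ 2 ≤ C0P * (κ2 ^ 2 * h ^ 2) := by gcongr
        _ = _ := by ring
    linarith
  · refine cc.trans (Real.exp_le_exp.mpr (neg_le_neg ?_))
    have hm0 : 0 ≤ min 1 ((h * τ) ^ 2) := le_min zero_le_one (sq_nonneg _)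
    refine (mul_le_mul_of_nonneg_right (min_le_right _ _) hm0).trans ?_
    rw [mul_assoc]
    apply mul_le_mul_of_nonneg_left _ (by positivity)
    apply le_min
    · calc min 1 (κ1 ^ 2) * min 1 ((h * τ) ^ 2) ≤ 1 * 1 :=
          mul_le_mul (min_le_left _ _) (min_le_left _ _) hm0 zero_le_one
        _ = 1 := by ring
    · calc min 1 (κ1 ^ 2) * min 1 ((h * τ) ^ 2) ≤ κ1 ^ 2 * (h * τ) ^ 2 :=
          mul_le_mul (min_le_right _ _) (min_le_right _ _) hm0 (by positivity)
        _ = (κ1 ^ 2 * h ^ 2) * τ ^ 2 := by ring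
        _ ≤ η ^ 2 * τ ^ 2 := by gcongr
        _ = _ := by ring
  · have e : vpart β l / h ^ 2 * (h * τ) ^ 2 / 2 = vpart β l * τ ^ 2 / 2 := by field_simp
    rw [e]
    refine ct.trans ?_
    have : 16 * (C0P + C0P ^ 3) * (η * |τ|) ^ 3 ≤ 16 * (C0P + C0P ^ 3) * κ2 ^ 3 * |h * τ| ^ 3 := by
      calc 16 * (C0P + C0P ^ 3) * (η * |τ|) ^ 3 ≤ 16 * (C0P + C0P ^ 3) * (κ2 * h * |τ|) ^ 3 := by gcongr
        _ = _ := by rw [abs_mul, abs_of_pos hh]; ring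
    refine this.trans ?_
    gcongr
    linarith
  · have : ‖cfun (partDensity β l) τ‖ * |h * τ| ≤ C0P / κ1 := by
      rw [abs_mul, abs_of_pos hh]
      calc ‖cfun (partDensity β l) τ‖ * (h * |τ|) = (‖cfun (partDensity β l) τ‖ * |τ|) * h := by ring
        _ ≤ C0P / η * h := by gcongr
        _ ≤ C0P / (κ1 * h) * h := by gcongr
        _ = _ := by field_simp
    linarith

lemma local_from_cf {f : ℝ → ℝ} (hf : Integrable f) (hc : Continuous f) {σ n A : ℝ}
    (hσ : 0 < σ) (hn : 0 < n)
    (hb : ∀ τ : ℝ, ‖cfun f τ * Complex.exp (-(Complex.I * τ)) -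
      ((Real.exp (-(σ ^ 2 * τ ^ 2 / 2)) : ℝ) : ℂ)‖ ≤ A * (1 + (τ / n) ^ 2)⁻¹) (x : ℝ) :
    |σ * f (1 + σ * x) - 1 / Real.sqrt (2 * Real.pi) * Real.exp (-x ^ 2 / 2)| ≤ σ * (A * n / 2) := by
  obtain ⟨i1, i2⟩ := scaled_cauchy 0 n hn
  simp only [sub_zero] at i1 i2
  have hcc := cfun_cont hf
  set G : ℝ → ℂ := fun τ => ((Real.exp (-(σ ^ 2 * τ ^ 2 / 2)) : ℝ) : ℂ) with hG
  have hGi : Integrable G := by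
    have := (integrable_exp_neg_mul_sq (show 0 < σ ^ 2 / 2 by positivity)).ofReal (𝕜 := ℂ)
    refine this.congr (Filter.Eventually.of_forall fun τ => ?_)
    simp only [hG]
    congr 2; ring
  set D : ℝ → ℂ := fun τ => cfun f τ * Complex.exp (-(Complex.I * τ)) - G τ with hD
  have hDc : Continuous D := by simp only [hD, hG]; fun_prop
  have hDi : Integrable D := (i1.const_mul A).mono' hDc.aestronglyMeasurable
    (Filter.Eventually.of_forall hb)
  have hE : ∀ s τ : ℝ, ‖Complex.exp (-(Complex.I * τ * s))‖ = 1 := by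
    intro s τ
    rw [show -(Complex.I * (τ:ℂ) * (s:ℂ)) = ((-(τ * s) : ℝ):ℂ) * Complex.I by
      push_cast; ring, Complex.norm_exp_ofReal_mul_I]
  have hDG : Integrable (fun τ => cfun f τ * Complex.exp (-(Complex.I * τ))) := by
    refine (hDi.add hGi).congr (Filter.Eventually.of_forall fun τ => ?_)
    simp [hD]
  have hi : Integrable (cfun f) := by
    refine hDG.norm.mono' hcc.aestronglyMeasurable (Filter.Eventually.of_forall fun τ => ?_)
    have := hE 1 τ
    simp only [Complex.ofReal_one, mul_one] at this
    rw [norm_mul, this, mul_one]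
  have hinv := fourier_inversion hf hc hi (1 + σ * x)
  have hmul : ∀ {g : ℝ → ℂ}, Integrable g →
      Integrable (fun τ : ℝ => Complex.exp (-(Complex.I * τ * (σ * x : ℝ))) * g τ) := by
    intro g hg
    refine hg.norm.mono' ((Continuous.aestronglyMeasurable (by fun_prop)).mul hg.aestronglyMeasurable)
      (Filter.Eventually.of_forall fun τ => ?_)
    rw [norm_mul, hE, one_mul]
  have hsplit : ∫ t : ℝ, Complex.exp (-(Complex.I * t * (1 + σ * x : ℝ))) * cfun f t =
      (∫ t : ℝ, Complex.exp (-(Complex.I * t * (σ * x : ℝ))) * D t) +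
      ∫ t : ℝ, Complex.exp (-(Complex.I * t * (σ * x : ℝ))) * G t := by
    rw [← integral_add (hmul hDi) (hmul hGi)]
    congr 1
    funext t
    rw [← mul_add]
    simp only [hD, sub_add_cancel]
    rw [mul_comm (cfun f t), ← mul_assoc, ← Complex.exp_add]
    congr 2
    push_cast; ring
  have hg := gauss_eval σ x hσ
  have hfin : ((σ * f (1 + σ * x) - 1 / Real.sqrt (2 * Real.pi) * Real.exp (-x ^ 2 / 2) : ℝ) : ℂ)
      = ((σ * (1 / (2 * Real.pi)) : ℝ) : ℂ) *
        ∫ t : ℝ, Complex.exp (-(Complex.I * t * (σ * x : ℝ))) * D t := by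
    have hg' : (σ:ℂ) * ((1 / (2 * Real.pi)) *
        ∫ t : ℝ, Complex.exp (-(Complex.I * t * (σ * x : ℝ))) * G t)
        = ((1 / Real.sqrt (2 * Real.pi) * Real.exp (-x ^ 2 / 2) : ℝ) : ℂ) := hg
    rw [Complex.ofReal_sub, ← hg', Complex.ofReal_mul, hinv, hsplit,
      show ((σ * (1 / (2 * Real.pi)) : ℝ) : ℂ) = (σ:ℂ) * (1 / (2 * Real.pi)) by push_cast; rfl]
    ring
  rw [← Real.norm_eq_abs, ← Complex.norm_real, hfin, norm_mul, Complex.norm_real, Real.norm_eq_abs,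
    abs_of_pos (by positivity)]
  have hI : ‖∫ t : ℝ, Complex.exp (-(Complex.I * t * (σ * x : ℝ))) * D t‖ ≤ A * (n * Real.pi) := by
    rw [← i2, ← integral_const_mul]
    refine norm_integral_le_of_norm_le (i1.const_mul A) (Filter.Eventually.of_forall fun τ => ?_)
    rw [norm_mul, hE, one_mul]
    exact hb τ
  calc _ ≤ σ * (1 / (2 * Real.pi)) * (A * (n * Real.pi)) := by gcongr
    _ = _ := by field_simp

theorem local_clt_subcritical (β F₀ : ℝ) (hβ : 0 < β)
    (hF₀0 : 0 ≤ F₀) (hF₀ : F₀ < 4 * β)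
    (F : ℕ → ℝ) (hF0 : ∀ N, 0 ≤ F N)
    (hF : Tendsto (fun N : ℕ => F N / N) atTop (nhds F₀))
    (lam : ℕ → ℝ)
    (hlam : ∀ N : ℕ, 2 ≤ N →
      ∑ k ∈ Finset.Icc 1 N, mpart β (lam N + (k : ℝ) * F N) = 1) :
    ∃ C > (0:ℝ), ∃ N₀ : ℕ, ∀ N ≥ N₀, ∀ x : ℝ,
      |Real.sqrt (∑ k ∈ Finset.Icc 1 N, vpart β (lam N + (k : ℝ) * F N)) *
          sumDensity β ((List.range N).map (fun k => lam N + ((k : ℝ) + 1) * F N))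
            (1 + Real.sqrt (∑ k ∈ Finset.Icc 1 N, vpart β (lam N + (k : ℝ) * F N)) * x)
        - (1 / Real.sqrt (2 * Real.pi)) * Real.exp (-x ^ 2 / 2)| ≤ C / Real.sqrt N := by
  obtain ⟨a, ha, b, hb, N₀, hloc⟩ := lam_location hβ hF₀0 hF₀ F hF0 hF lam hlam
  obtain ⟨c, hc, C, hC, N₁, hpb⟩ := part_bounds hβ ha hb
  obtain ⟨K, hK, hprod⟩ := prod_bound c C hc hC
  refine ⟨Real.sqrt C * K / 2, by positivity, N₀ + N₁ + 2, ?_⟩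
  intro N hN x
  obtain ⟨lo, hi⟩ := hloc N (by omega)
  have hN2 : 2 ≤ N := by omega
  have hN2' : (2:ℝ) ≤ N := by exact_mod_cast hN2
  have hNpos : (0:ℝ) < N := by linarith
  have hsm := hlam N hN2
  rw [sum_Icc_range N (fun t => mpart β (lam N + t * F N))] at hsm
  rw [sum_Icc_range N (fun t => vpart β (lam N + t * F N))]
  set l : ℕ → ℝ := fun k => lam N + ((k : ℝ) + 1) * F N with hl
  set V := ∑ k ∈ Finset.range N, vpart β (l k) with hV
  set σ := Real.sqrt V with hσ
  set h := Real.sqrt (1 / (N:ℝ) ^ 3) with hh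
  have hh0 : 0 < h := Real.sqrt_pos.mpr (by positivity)
  have hh2 : h ^ 2 = 1 / (N:ℝ) ^ 3 := Real.sq_sqrt (by positivity)
  have hhN : h ^ 2 * (N:ℝ) ^ 3 = 1 := by rw [hh2]; field_simp
  have hlk : ∀ k < N, a * (N:ℝ) ^ 2 ≤ l k ∧ l k ≤ b * (N:ℝ) ^ 2 := by
    intro k hk
    have hk' : (k:ℝ) + 1 ≤ N := by exact_mod_cast hk
    have h1 : 0 ≤ ((k:ℝ) + 1) * F N := mul_nonneg (by positivity) (hF0 N)
    have h2 : ((k:ℝ) + 1) * F N ≤ N * F N := mul_le_mul_of_nonneg_right hk' (hF0 N)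
    simp only [hl]
    constructor <;> linarith
  have hB := fun τ k (hk : k < N) => hpb N (by omega) hN2 h hh0 hhN (l k) (hlk k hk).1 (hlk k hk).2 τ
  have hsumv : ∑ k ∈ Finset.range N, vpart β (l k) / h ^ 2 = V / h ^ 2 := by
    rw [hV, Finset.sum_div]
  have hVpos : 0 < V := by
    apply Finset.sum_pos _ ⟨0, by simp; omega⟩
    intro k hk
    have := (hB 0 k (Finset.mem_range.mp hk)).1
    rw [le_div_iff₀ (by positivity)] at this
    have : 0 < c * h ^ 2 := by positivity
    linarith
  have hVle : V ≤ C / (N:ℝ) ^ 2 := by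
    have : V ≤ ∑ k ∈ Finset.range N, C * h ^ 2 := by
      apply Finset.sum_le_sum
      intro k hk
      have := (hB 0 k (Finset.mem_range.mp hk)).2.1
      rwa [div_le_iff₀ (by positivity)] at this
    refine this.trans (le_of_eq ?_)
    rw [Finset.sum_const, Finset.card_range, nsmul_eq_mul, hh2]
    field_simp
  have hσ0 : 0 < σ := Real.sqrt_pos.mpr hVpos
  have hσ2 : σ ^ 2 = V := Real.sq_sqrt hVpos.le
  have hσle : σ ≤ Real.sqrt C / N := by
    rw [hσ]
    refine (Real.sqrt_le_sqrt hVle).trans (le_of_eq ?_)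
    rw [Real.sqrt_div hC.le, Real.sqrt_sq hNpos.le]
  have hnice := fun l => partDensity_nice β hβ l
  have hne : (List.range N).map l ≠ [] := by simp; omega
  have hS := sumDensity_nice β hnice _ hne
  have hSc := sumDensity_cont β hnice ((List.range N).map l) (by simp; omega)
  have hcf : ∀ τ : ℝ, ‖cfun (sumDensity β ((List.range N).map l)) τ * Complex.exp (-(Complex.I * τ)) -
      ((Real.exp (-(σ ^ 2 * τ ^ 2 / 2)) : ℝ) : ℂ)‖ ≤ K / Real.sqrt N * (1 + (τ / N) ^ 2)⁻¹ := by
    intro τ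
    have := hprod N hN2 (fun k => cfun (partDensity β (l k)) τ *
      Complex.exp (-(Complex.I * τ * mpart β (l k)))) (fun k => vpart β (l k) / h ^ 2) (h * τ)
      (fun k hk => hB τ k hk)
    rw [hsumv, Finset.prod_mul_distrib, ← Complex.exp_sum] at this
    have e1 : ∑ k ∈ Finset.range N, -(Complex.I * τ * (mpart β (l k) : ℂ)) = -(Complex.I * τ) := by
      rw [Finset.sum_neg_distrib, ← Finset.mul_sum, ← Complex.ofReal_sum, hsm]
      simp
    have e2 : V / h ^ 2 * (h * τ) ^ 2 / 2 = σ ^ 2 * τ ^ 2 / 2 := by rw [hσ2]; field_simp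
    have e3 : (N:ℝ) * (h * τ) ^ 2 = (τ / N) ^ 2 := by
      rw [mul_pow, hh2]; field_simp
    rw [e1, e2, e3] at this
    rwa [sumDensity_cfun β hnice τ _ hne, range_map_prod N l]
  have hlist : (List.map (fun k : ℝ => lam N + (k + 1) * F N) (do
      let a ← List.range N
      pure (a:ℝ))) = (List.range N).map l := by
    simp [hl, List.map_eq_flatMap, List.flatMap_assoc]
  rw [hlist]
  refine (local_from_cf hS.int hSc hσ0 hNpos hcf x).trans ?_
  calc σ * (K / Real.sqrt N * N / 2) ≤ Real.sqrt C / N * (K / Real.sqrt N * N / 2) := by gcongr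
    _ = _ := by field_simp
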